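/- arXiv:1511.03478 — 9 statements merged into one kernel-verified Lean document; each statement's English description precedes it below -/
import Mathlib

section
/- Suppose γ is a flow on a compact metric space Y, p ∈ Y, T > 0, and γ(p,t) ≠ p for every t with 0 < |t| ≤ 4T. Then there exists a closed set F ⊆ Y such that γ maps F × [−T,T] homeomorphically onto a set which is a neighborhood of p in Y. -/
open Set Topology

section FlowDefs

variable {Y Y' : Type*} [TopologicalSpace Y] [TopologicalSpace Y']

/-- A fixed point free continuous flow on a topological space. -/
def IsFlow (γ : Y → ℝ → Y) : Prop :=
  Continuous (fun p : Y × ℝ => γ p.1 p.2) ∧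
  (∀ y s t, γ (γ y s) t = γ y (s + t)) ∧
  (∀ y, γ y 0 = y) ∧
  (∀ y, ∃ t, γ y t ≠ y)

/-- The orbit of a point under a flow. -/
def flowOrbit (γ : Y → ℝ → Y) (y : Y) : Set Y := Set.range (γ y)

/-- A cross section of a flow: a closed subset `C` such that
`(x,t) ↦ γ x t` is surjective `C × ℝ → Y` and a local homeomorphism. -/
def IsCrossSection (γ : Y → ℝ → Y) (C : Set Y) : Prop :=
  IsClosed C ∧
  Function.Surjective (fun p : C × ℝ => γ p.1.1 p.2) ∧
  IsLocalHomeomorph (fun p : C × ℝ => γ p.1.1 p.2)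

/-- A flow map: a continuous map sending each orbit onto an orbit by an
orientation preserving local homeomorphism. -/
def IsFlowMap (γ : Y → ℝ → Y) (γ' : Y' → ℝ → Y') (h : Y → Y') : Prop :=
  Continuous h ∧
  (∀ y, h '' flowOrbit γ y = flowOrbit γ' (h y)) ∧
  (∀ y, ∃ ε > (0:ℝ), ∃ c : ℝ → ℝ,
    ContinuousOn c (Ioo (-ε) ε) ∧ StrictMonoOn c (Ioo (-ε) ε) ∧ c 0 = 0 ∧
    ∀ t : ℝ, |t| < ε → h (γ y t) = γ' (h y) (c t))

/-- Membership in `Homeo₊(Y)`: a self flow equivalence. -/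
def MemHomeoPlus (γ : Y → ℝ → Y) (h : Y → Y) : Prop :=
  IsFlowMap γ γ h ∧ IsHomeomorph h

/-- Membership in `Homeo₊ᵒʳᵇ(Y)`: a self flow equivalence mapping each orbit onto itself. -/
def MemHomeoPlusOrb (γ : Y → ℝ → Y) (h : Y → Y) : Prop :=
  MemHomeoPlus γ h ∧ ∀ y, h '' flowOrbit γ y = flowOrbit γ y

/-- Membership in `Homeo₊ⁱˢᵒ(Y)`: an element of `Homeo₊ᵒʳᵇ(Y)` isotopic to the identity
within `Homeo₊(Y)`. -/
def MemHomeoPlusIso (γ : Y → ℝ → Y) (h : Y → Y) : Prop :=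
  MemHomeoPlusOrb γ h ∧
  ∃ H : Y → ℝ → Y,
    ContinuousOn (fun p : Y × ℝ => H p.1 p.2) (Set.univ ×ˢ Set.Icc 0 1) ∧
    (∀ t ∈ Set.Icc (0:ℝ) 1, MemHomeoPlus γ (fun y => H y t)) ∧
    (∀ y, H y 0 = y) ∧ (∀ y, H y 1 = h y)

/-- A discrete cross section for a (homeomorphic) self-map `T` of a space:
a closed set meeting every orbit, with well-defined continuous return time. -/
def IsDiscreteCrossSection {Z : Type*} [TopologicalSpace Z] (T : Z → Z) (K : Set Z) : Prop :=
  IsClosed K ∧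
  (∀ z : Z, ∃ x ∈ K, ∃ k : ℕ, T^[k] x = z) ∧
  ∃ r : K → ℕ, Continuous r ∧ ∀ x : K, IsLeast {k : ℕ | 1 ≤ k ∧ T^[k] (x : Z) ∈ K} (r x)

end FlowDefs

section SubshiftDefs

/-- The left shift on bisequences. -/
def shiftMap {A : Type*} : (ℤ → A) → (ℤ → A) := fun x n => x (n + 1)

/-- The word `w` occurs in `x` at position `n`. -/
def wordOccursAt {A : Type*} (w : List A) (x : ℤ → A) (n : ℤ) : Prop :=
  ∀ (i : ℕ) (hi : i < w.length), x (n + i) = w.get ⟨i, hi⟩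

/-- The word `w` occurs in some point of `X`. -/
def wordOccursIn {A : Type*} (w : List A) (X : Set (ℤ → A)) : Prop :=
  ∃ x ∈ X, ∃ n : ℤ, wordOccursAt w x n

/-- A subshift: nonempty, closed, shift-invariant subset of `A^ℤ`. -/
def IsSubshift {A : Type*} [TopologicalSpace A] (X : Set (ℤ → A)) : Prop :=
  X.Nonempty ∧ IsClosed X ∧ shiftMap '' X = X

/-- A shift of finite type: the set of bisequences avoiding a finite set of forbidden words. -/
def IsSFT {A : Type*} (X : Set (ℤ → A)) : Prop :=
  ∃ F : Set (List A), F.Finite ∧ X = {x | ∀ w ∈ F, ∀ n : ℤ, ¬ wordOccursAt w x n}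

/-- An irreducible subshift. -/
def IsIrreducibleSubshift {A : Type*} (X : Set (ℤ → A)) : Prop :=
  ∀ u v : List A, wordOccursIn u X → wordOccursIn v X →
    ∃ w : List A, wordOccursIn (u ++ w ++ v) X

end SubshiftDefs

/-- The integral of a continuous observable over a time window of length `a` increases strictly
along an orbit segment on which the observable increases over time `a`. -/
theorem IsFlow.integral_lt_integral {Y : Type*} [TopologicalSpace Y] {γ : Y → ℝ → Y}
    (hγ : IsFlow γ) {f : Y → ℝ} (hf : Continuous f) {a t : ℝ} (ht : 0 < t) {y : Y}
    (h : ∀ s ∈ Icc 0 t, f (γ y s) < f (γ (γ y s) a)) :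
    ∫ s in (0 : ℝ)..a, f (γ y s) < ∫ s in (0 : ℝ)..a, f (γ (γ y t) s) := by
  obtain ⟨hc, hadd, -, -⟩ := hγ
  have hk : Continuous fun s => f (γ y s) := hf.comp (hc.comp (by fun_prop : Continuous (y, ·)))
  have hka : Continuous fun s => f (γ y (s + a)) := hk.comp (by fun_prop : Continuous (· + a))
  have hi (u v : ℝ) : IntervalIntegrable (fun s => f (γ y s)) MeasureTheory.volume u v :=
    hk.intervalIntegrable u v
  have hlt : ∫ s in (0 : ℝ)..t, f (γ y s) < ∫ s in (0 : ℝ)..t, f (γ y (s + a)) := by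
    refine intervalIntegral.integral_lt_integral_of_continuousOn_of_le_of_exists_lt ht
      hk.continuousOn hka.continuousOn (fun s hs => ?_) ⟨0, ⟨le_rfl, ht.le⟩, ?_⟩
    · simpa only [hadd] using (h s ⟨hs.1.le, hs.2⟩).le
    · simpa only [hadd] using h 0 ⟨le_rfl, ht.le⟩
  rw [intervalIntegral.integral_comp_add_right (fun s => f (γ y s)) a] at hlt
  simp only [hadd]
  rw [intervalIntegral.integral_comp_add_left (fun s => f (γ y s)) t]
  have h₁ := intervalIntegral.integral_add_adjacent_intervals (hi 0 t) (hi t (t + a))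
  have h₂ := intervalIntegral.integral_add_adjacent_intervals (hi 0 a) (hi a (t + a))
  simp only [zero_add, add_zero] at *
  linarith

/-- A closed set whose points do not return to it within time `2 * T` is the base of a flow box. -/
theorem IsFlow.isHomeomorph_rangeFactorization {Y : Type*} [TopologicalSpace Y] [T2Space Y]
    [CompactSpace Y] {γ : Y → ℝ → Y} (hγ : IsFlow γ) {F : Set Y} (hF : IsClosed F) {T : ℝ}
    (h : ∀ x ∈ F, ∀ r, |r| ≤ 2 * T → γ x r ∈ F → r = 0) :
    IsHomeomorph (rangeFactorization (fun q : F × Icc (-T) T => γ q.1.1 q.2.1)) := by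
  obtain ⟨hc, hadd, hzero, -⟩ := hγ
  have : CompactSpace F := isCompact_iff_compactSpace.mp hF.isCompact
  rw [isHomeomorph_iff_continuous_bijective]
  refine ⟨?_, ?_, rangeFactorization_surjective⟩
  · refine Continuous.subtype_mk ?_ _
    exact hc.comp (by fun_prop : Continuous fun q : F × Icc (-T) T => (q.1.1, q.2.1))
  · rw [rangeFactorization_injective]
    rintro ⟨⟨x, hx⟩, ⟨s, hs⟩⟩ ⟨⟨y, hy⟩, ⟨t, ht⟩⟩ hst
    have hxy : γ x (s - t) = y := by
      have := congrArg (γ · (-t)) hst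
      simpa [hadd, hzero, ← sub_eq_add_neg] using this
    have hr : s - t = 0 := by
      refine h x hx _ ?_ (hxy ▸ hy)
      rw [abs_le]
      constructor <;> linarith [hs.1, hs.2, ht.1, ht.2]
    have hst' : s = t := by linarith
    rw [hr, hzero] at hxy
    subst hxy hst'
    rfl

/-- Points near `p` remain in a neighborhood of `p` for small times. -/
theorem IsFlow.exists_forall_mem {Y : Type*} [TopologicalSpace Y] {γ : Y → ℝ → Y}
    (hγ : IsFlow γ) {p : Y} {U : Set Y} (hU : U ∈ 𝓝 p) {b : ℝ} (hb : 0 < b) :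
    ∃ ε, 0 < ε ∧ ε ≤ b ∧ ∀ᶠ y in 𝓝 p, ∀ s, |s| ≤ ε → γ y s ∈ U := by
  have h : ∀ᶠ q : Y × ℝ in 𝓝 p ×ˢ 𝓝 0, γ q.1 q.2 ∈ U := by
    rw [← nhds_prod_eq]
    refine hγ.1.continuousAt.eventually_mem ?_
    simpa [hγ.2.2.1] using hU
  obtain ⟨P, hP, Q, hQ, hPQ⟩ := Filter.eventually_prod_iff.mp h
  obtain ⟨ε, hε, hεQ⟩ := Metric.eventually_nhds_iff.mp hQ
  refine ⟨min (ε / 2) b, by positivity, min_le_right _ _, hP.mono fun y hy s hs => ?_⟩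
  refine hPQ hy (hεQ ?_)
  rw [Real.dist_eq, sub_zero]
  linarith [min_le_left (ε / 2) b]

/-- Existence of a local cross section / flowbox neighborhood (Theorem 2.5 of the paper). -/
theorem exists_local_cross_section {Y : Type*} [MetricSpace Y] [CompactSpace Y]
    (γ : Y → ℝ → Y) (hγ : IsFlow γ) (p : Y) (T : ℝ) (hT : 0 < T)
    (hper : ∀ t : ℝ, 0 < |t| → |t| ≤ 4 * T → γ p t ≠ p) :
    ∃ F : Set Y, IsClosed F ∧
      IsHomeomorph (Set.rangeFactorization (fun q : F × (Set.Icc (-T) T) => γ q.1.1 q.2.1)) ∧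
      Set.range (fun q : F × (Set.Icc (-T) T) => γ q.1.1 q.2.1) ∈ nhds p := by
  have hc := hγ.1
  have hadd := hγ.2.1
  have hzero := hγ.2.2.1
  have hcs (s : ℝ) : Continuous (γ · s) := hc.comp (by fun_prop : Continuous (·, s))
  have hcy (y : Y) : Continuous (γ y) := hc.comp (by fun_prop : Continuous (y, ·))
  set f : Y → ℝ := fun y => dist y p
  have hf : Continuous f := by fun_prop
  set g : Y → ℝ := fun y => ∫ s in (0 : ℝ)..T, f (γ y s)
  have hg : Continuous g :=
    intervalIntegral.continuous_parametric_intervalIntegral_of_continuous'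
      (f := fun y s => f (γ y s)) (hf.comp hc) 0 T
  have hU : {y | f y < f (γ y T)} ∈ 𝓝 p := by
    refine (isOpen_lt hf (hf.comp (hcs T))).mem_nhds ?_
    have hp : γ p T ≠ p := hper T (abs_pos.mpr hT.ne') (by rw [abs_of_pos hT]; linarith)
    simpa [f] using hp
  obtain ⟨ε, hε, hεT, hloc⟩ := hγ.exists_forall_mem hU hT
  have hmono {y : Y} (hy : ∀ s, |s| ≤ ε → f (γ y s) < f (γ (γ y s) T)) {t : ℝ} (ht : 0 < t)
      (htε : t ≤ ε) : g y < g (γ y t) :=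
    hγ.integral_lt_integral hf ht fun s hs =>
      hy s (by rw [abs_of_nonneg hs.1]; exact hs.2.trans htε)
  have hret : ∀ᶠ q : Y × Y in 𝓝 (p, p), ∀ t ∈ {t : ℝ | ε ≤ |t|} ∩ Icc (-(2 * T)) (2 * T),
      γ q.1 t ≠ q.2 := by
    refine IsCompact.eventually_forall_of_forall_eventually
      (isCompact_Icc.inter_left (isClosed_le continuous_const continuous_abs)) fun t ht => ?_
    have hopen : IsOpen {z : (Y × Y) × ℝ | γ z.1.1 z.2 ≠ z.1.2} :=
      isOpen_ne_fun (hc.comp (by fun_prop : Continuous fun z : (Y × Y) × ℝ => (z.1.1, z.2)))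
        (by fun_prop)
    exact hopen.mem_nhds
      (hper t (hε.trans_le ht.1) (by linarith [abs_le.mpr ⟨ht.2.1, ht.2.2⟩]))
  rw [nhds_prod_eq] at hret
  obtain ⟨V, hV, hVret⟩ := Filter.eventually_prod_self_iff'.mp hret
  obtain ⟨B, ⟨hB, hBc⟩, hBsub⟩ :=
    (closed_nhds_basis p).mem_iff.mp (Filter.inter_mem hloc hV)
  have hF : IsClosed (B ∩ {y | g y = g p}) := hBc.inter (isClosed_eq hg continuous_const)
  refine ⟨_, hF, hγ.isHomeomorph_rangeFactorization hF ?_, ?_⟩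
  · rintro x ⟨hxB, hx⟩ r hr ⟨hyB, hy⟩
    by_contra hr0
    rw [mem_ofPred_eq] at hx hy
    rcases le_or_gt ε |r| with hεr | hrε
    · exact hVret x (hBsub hxB).2 _ (hBsub hyB).2 r ⟨hεr, abs_le.mp hr⟩ rfl
    · obtain ⟨h₁, h₂⟩ := abs_lt.mp hrε
      rcases lt_or_gt_of_ne hr0 with hneg | hpos
      · have := hmono (hBsub hyB).1 (t := -r) (by linarith) (by linarith)
        rw [hadd, add_neg_cancel, hzero] at this
        linarith
      · have := hmono (hBsub hxB).1 hpos h₂.le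
        linarith
  · obtain ⟨η, hη, hηε, hlocB⟩ := hγ.exists_forall_mem hB hε
    have hpos : g p < g (γ p η) := hmono hloc.self_of_nhds hη hηε
    have hneg : g (γ p (-η)) < g p := by
      have h := hγ.integral_lt_integral hf (a := T) hη (y := γ p (-η)) fun s hs => by
        rw [hadd]
        refine hloc.self_of_nhds _ ?_
        rw [abs_le]
        constructor <;> linarith [hs.1, hs.2]
      rwa [hadd, neg_add_cancel, hzero] at h
    filter_upwards [hlocB,
      (hg.comp (hcs η)).continuousAt.eventually_const_lt hpos,
      (hg.comp (hcs (-η))).continuousAt.eventually_lt_const hneg] with z hz hzpos hzneg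
    obtain ⟨τ, hτ, hτg⟩ := intermediate_value_Icc (by linarith : -η ≤ η)
      (hg.comp (hcy z)).continuousOn ⟨hzneg.le, hzpos.le⟩
    refine ⟨(⟨γ z τ, hz τ (abs_le.mpr hτ), hτg⟩, ⟨-τ, ?_, ?_⟩), ?_⟩
    · linarith [hτ.2]
    · linarith [hτ.1]
    · simp [hadd, hzero]
end

section
/- Suppose π : Y → Y' is a surjective flow map between flows (Y,γ) and (Y',γ'), and C ⊆ Y, C' ⊆ Y' are subsets with C = π⁻¹(C'). Then C is a cross section of the flow γ on Y if and only if C' is a cross section of the flow γ' on Y'. -/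
open Set Topology

open Filter

section FlowLemmas

variable {Y Y' : Type*} [TopologicalSpace Y] [TopologicalSpace Y']

theorem IsFlow.continuous_comp {γ : Y → ℝ → Y} (hγ : IsFlow γ) {X : Type*} [TopologicalSpace X]
    {f : X → Y} {g : X → ℝ} (hf : Continuous f) (hg : Continuous g) :
    Continuous fun x => γ (f x) (g x) :=
  hγ.1.comp (hf.prodMk hg)

theorem IsFlow.zsmul_period {γ : Y → ℝ → Y} (hγ : IsFlow γ) {y : Y} {u : ℝ} (h : γ y u = y)
    (k : ℤ) : γ y (k * u) = y := by
  induction k using Int.induction_on with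
  | zero => simpa using hγ.2.2.1 y
  | succ n ih =>
    have := hγ.2.1 y (n * u) u
    push_cast at ih ⊢
    rw [ih, h] at this
    rw [add_mul, one_mul, ← this]
  | pred n ih =>
    have h' : γ y (-u) = y := by
      have := hγ.2.1 y u (-u)
      rwa [h, add_neg_cancel, hγ.2.2.1] at this
    have := hγ.2.1 y (-n * u) (-u)
    push_cast at ih ⊢
    rw [ih, h'] at this
    rw [sub_mul, one_mul, sub_eq_add_neg, ← this]

/-- A fixed point free flow on a compact space has no arbitrarily small periods. -/
theorem IsFlow.eventually_period_eq_zero [T2Space Y] [CompactSpace Y] {γ : Y → ℝ → Y}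
    (hγ : IsFlow γ) : ∀ᶠ u in 𝓝 (0 : ℝ), ∀ y, γ y u = y → u = 0 := by
  suffices H : ∀ᶠ u in 𝓝 (0 : ℝ), ∀ y ∈ (univ : Set Y), γ y u = y → u = 0 by simpa using H
  refine isCompact_univ.eventually_forall_of_forall_eventually fun x _ => ?_
  obtain ⟨t, ht⟩ := hγ.2.2.2 x
  have h1 : ∀ᶠ p : Y × ℝ in 𝓝 (x, t), γ p.1 p.2 ≠ p.1 :=
    (isOpen_ne_fun hγ.1 continuous_fst).mem_nhds ht
  rw [nhds_prod_eq, eventually_prod_iff] at h1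
  obtain ⟨p, hp, q, hq, hpq⟩ := h1
  obtain ⟨δ, hδ, hq⟩ := Metric.eventually_nhds_iff.1 hq
  rw [nhds_prod_eq, eventually_prod_iff]
  refine ⟨fun u => |u| < δ, ?_, p, hp, ?_⟩
  · filter_upwards [Metric.ball_mem_nhds (0 : ℝ) hδ] with u hu
    simpa using hu
  · intro u hu y hy hper
    by_contra hne
    refine hpq hy (hq (y := round (t / u) * u) ?_) (hγ.zsmul_period hper _)
    have h2 := abs_sub_round (t / u)
    have h3 : (round (t / u) : ℝ) * u - t = -((t / u - round (t / u)) * u) := by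
      field_simp
      ring
    rw [Real.dist_eq, h3, abs_neg, abs_mul]
    nlinarith [abs_nonneg u]

/-- On a closed set, the flow-box map is a local homeomorphism iff return times to the set are
bounded away from zero and points near the set flow into it within a small time. -/
theorem IsFlow.isLocalHomeomorph_iff [CompactSpace Y] {γ : Y → ℝ → Y} (hγ : IsFlow γ) {C : Set Y}
    (hC : IsClosed C) :
    IsLocalHomeomorph (fun p : C × ℝ => γ p.1.1 p.2) ↔
      (∀ᶠ t in 𝓝 (0 : ℝ), ∀ z ∈ C, γ z t ∈ C → t = 0) ∧
      ∀ x ∈ C, ∀ ε > 0, ∀ᶠ y in 𝓝 x, ∃ t, |t| < ε ∧ γ y t ∈ C := by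
  have hcont : Continuous fun p : C × ℝ => γ p.1.1 p.2 := by
    exact hγ.continuous_comp (continuous_subtype_val.comp continuous_fst) continuous_snd
  have hback : ∀ y s, γ (γ y s) (-s) = y := fun y s => by
    rw [hγ.2.1, add_neg_cancel, hγ.2.2.1]
  constructor
  · intro hloc
    constructor
    · suffices H : ∀ᶠ t in 𝓝 (0 : ℝ), ∀ z ∈ C, z ∈ C → γ z t ∈ C → t = 0 from
        H.mono fun t h z hz => h z hz hz
      refine hC.isCompact.eventually_forall_of_forall_eventually fun x hx => ?_
      obtain ⟨U, hU, hemb⟩ :=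
        isLocalHomeomorph_iff_isOpenEmbedding_restrict.1 hloc (⟨x, hx⟩, 0)
      rw [nhds_prod_eq, mem_prod_iff] at hU
      obtain ⟨A, hA, B, hB, hAB⟩ := hU
      obtain ⟨A', hA', hAA'⟩ := mem_nhds_subtype _ _ _ |>.1 hA
      have h1 : ∀ᶠ p : ℝ × Y in 𝓝 (0, x), p.1 ∈ B :=
        continuous_fst.continuousAt.eventually_mem hB
      have h2 : ∀ᶠ p : ℝ × Y in 𝓝 (0, x), p.2 ∈ A' :=
        continuous_snd.continuousAt.eventually_mem hA'
      have h3 : ∀ᶠ p : ℝ × Y in 𝓝 (0, x), γ p.2 p.1 ∈ A' := by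
        refine (hγ.continuous_comp continuous_snd continuous_fst).continuousAt.eventually_mem ?_
        simpa [hγ.2.2.1] using hA'
      filter_upwards [h1, h2, h3] with p h1 h2 h3 hp hz
      have m1 : ((⟨p.2, hp⟩, p.1) : C × ℝ) ∈ U := hAB ⟨hAA' h2, h1⟩
      have m2 : ((⟨γ p.2 p.1, hz⟩, 0) : C × ℝ) ∈ U := hAB ⟨hAA' h3, mem_of_mem_nhds hB⟩
      have := @hemb.injective ⟨_, m1⟩ ⟨_, m2⟩ (by simp [hγ.2.2.1])
      simpa using congrArg (fun q => q.1.2) this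
    · intro x hx ε hε
      have h1 : (univ ×ˢ Ioo (-ε) ε : Set (C × ℝ)) ∈ 𝓝 ((⟨x, hx⟩, 0) : C × ℝ) :=
        prod_mem_nhds univ_mem (Ioo_mem_nhds (by linarith) hε)
      have h2 := hloc.isOpenMap.image_mem_nhds h1
      simp only [hγ.2.2.1] at h2
      filter_upwards [h2] with y hy
      obtain ⟨⟨z, s⟩, ⟨-, hs⟩, rfl⟩ := hy
      refine ⟨-s, by rw [abs_neg]; exact abs_lt.2 hs, ?_⟩
      simp only [hback]
      exact z.2
  · rintro ⟨hsep, hnear⟩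
    have hopen : IsOpenMap fun p : C × ℝ => γ p.1.1 p.2 := by
      rw [isOpenMap_iff_nhds_le]
      rintro ⟨⟨x, hx⟩, s⟩ W hW
      rw [mem_map, nhds_prod_eq, mem_prod_iff] at hW
      obtain ⟨A, hA, B, hB, hAB⟩ := hW
      obtain ⟨A', hA', hAA'⟩ := mem_nhds_subtype _ _ _ |>.1 hA
      have h1 : ∀ᶠ p : Y × ℝ in 𝓝 (x, 0), γ p.1 p.2 ∈ A' := by
        refine hγ.1.continuousAt.eventually_mem ?_
        simpa [hγ.2.2.1] using hA'
      have h2 : ∀ᶠ p : Y × ℝ in 𝓝 (x, 0), s - p.2 ∈ B := by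
        refine (continuous_const.sub continuous_snd).continuousAt.eventually_mem ?_
        simpa using hB
      have h3 := h1.and h2
      rw [nhds_prod_eq, eventually_prod_iff] at h3
      obtain ⟨P, hP, Q, hQ, hPQ⟩ := h3
      obtain ⟨ε, hε, hQ⟩ := Metric.eventually_nhds_iff.1 hQ
      have h4 : ∀ᶠ y in 𝓝 (γ x s), P (γ y (-s)) ∧ ∃ t, |t| < ε ∧ γ (γ y (-s)) t ∈ C := by
        have := (hγ.continuous_comp continuous_id (continuous_const (y := -s))).continuousAt
          (x := γ x s)
        refine this.eventually (p := fun w => P w ∧ ∃ t, |t| < ε ∧ γ w t ∈ C) ?_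
        simp only [id, hback]
        exact hP.and (hnear x hx ε hε)
      filter_upwards [h4] with y hy
      obtain ⟨hy, t, ht, htC⟩ := hy
      obtain ⟨ha, hb⟩ := hPQ hy (hQ (y := t) (by simpa using ht))
      have := hAB (show ((⟨_, htC⟩, s - t) : C × ℝ) ∈ A ×ˢ B from ⟨hAA' ha, hb⟩)
      simpa [hγ.2.1, hγ.2.2.1] using this
    obtain ⟨ε, hε, hsep⟩ := Metric.eventually_nhds_iff.1 hsep
    rw [isLocalHomeomorph_iff_isOpenEmbedding_restrict]
    rintro ⟨x, s⟩
    have hU : IsOpen (univ ×ˢ Ioo (s - ε / 2) (s + ε / 2) : Set (C × ℝ)) :=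
      isOpen_univ.prod isOpen_Ioo
    refine ⟨univ ×ˢ Ioo (s - ε / 2) (s + ε / 2), hU.mem_nhds ⟨mem_univ _, ?_⟩, ?_⟩
    · constructor <;> dsimp only <;> linarith
    · refine .of_continuous_injective_isOpenMap (hcont.comp continuous_subtype_val) ?_
        (hopen.domRestrict hU)
      rintro ⟨⟨z, t⟩, _, ht⟩ ⟨⟨w, r⟩, _, hr⟩ hzwr
      have h : γ z t = γ w r := hzwr
      have hw : γ z (t - r) = w := by
        rw [sub_eq_add_neg, ← hγ.2.1, h, hback]
      have h0 : t - r = 0 := by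
        refine hsep ?_ z z.2 (hw ▸ w.2)
        rw [Real.dist_eq, sub_zero, abs_lt]
        constructor <;> linarith [ht.1, ht.2, hr.1, hr.2]
      rw [h0, hγ.2.2.1] at hw
      have hzw : z = w := Subtype.ext hw
      have htr : t = r := by linarith
      subst hzw htr
      rfl

theorem ContinuousOn.strictMonoOn_Icc_of_eventually_nhdsGT {f : ℝ → ℝ} {a b : ℝ}
    (hf : ContinuousOn f (Icc a b)) (h : ∀ x ∈ Ico a b, ∀ᶠ y in 𝓝[>] x, f x < f y) :
    StrictMonoOn f (Icc a b) := by
  have hmono : MonotoneOn f (Icc a b) := by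
    intro x hx y hy hxy
    have hsub : Icc x y ⊆ {t | f x ≤ f t} := by
      refine IsClosed.Icc_subset_of_forall_mem_nhdsWithin ?_ (le_refl (f x)) ?_
      · rw [inter_comm]
        exact (hf.mono (Icc_subset_Icc hx.1 hy.2)).preimage_isClosed_of_isClosed isClosed_Icc
          isClosed_Ici
      · rintro t ⟨ht, ht'⟩
        filter_upwards [h t ⟨hx.1.trans ht'.1, ht'.2.trans_le hy.2⟩] with s hs
        exact le_trans ht hs.le
    exact hsub ⟨hxy, le_rfl⟩
  intro x hx y hy hxy
  have h1 : ∀ᶠ s in 𝓝[>] x, s ∈ Ioo x y := Ioo_mem_nhdsGT hxy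
  obtain ⟨s, hs, hs'⟩ := ((h x ⟨hx.1, hxy.trans_le hy.2⟩).and h1).exists
  exact hs.trans_le (hmono ⟨hx.1.trans hs'.1.le, hs'.2.le.trans hy.2⟩ hy hs'.2.le)

/-- A flow map between compact spaces lifts, for short times, to a continuous time change. -/
theorem IsFlowMap.exists_time_change [CompactSpace Y] [T2Space Y'] [CompactSpace Y']
    {γ : Y → ℝ → Y} {γ' : Y' → ℝ → Y'} (hγ : IsFlow γ) (hγ' : IsFlow γ') {π : Y → Y'}
    (hπ : IsFlowMap γ γ' π) :
    ∃ η > 0, ∃ c : Y → ℝ → ℝ,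
      ContinuousOn (fun p : Y × ℝ => c p.1 p.2) (univ ×ˢ Icc (-η) η) ∧
      ∀ y, c y 0 = 0 ∧ StrictMonoOn (c y) (Icc (-η) η) ∧
        ∀ t ∈ Icc (-η) η, π (γ y t) = γ' (π y) (c y t) := by
  obtain ⟨δ, hδ, hper⟩ := Metric.eventually_nhds_iff.1 hγ'.eventually_period_eq_zero
  obtain ⟨ρ, hρ, hρδ⟩ : ∃ ρ > 0, 2 * ρ < δ := ⟨δ / 3, by positivity, by linarith⟩
  have huniq : ∀ y, ∀ u ∈ Icc (-ρ) ρ, ∀ v ∈ Icc (-ρ) ρ, γ' y u = γ' y v → u = v := by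
    intro y u hu v hv h
    have : u - v = 0 := by
      refine hper ?_ (γ' y v) ?_
      · rw [Real.dist_eq, sub_zero, abs_lt]
        constructor <;> linarith [hu.1, hu.2, hv.1, hv.2]
      · rw [hγ'.2.1, add_sub_cancel, h]
    linarith
  have hπγ : Continuous fun p : Y × ℝ => π (γ p.1 p.2) := hπ.1.comp hγ.1
  have hend : ∀ᶠ t in 𝓝 (0 : ℝ), ∀ y ∈ (univ : Set Y),
      π (γ y t) ≠ γ' (π y) ρ ∧ π (γ y t) ≠ γ' (π y) (-ρ) := by
    refine isCompact_univ.eventually_forall_of_forall_eventually fun x _ => ?_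
    have key : ∀ r ∈ Icc (-ρ) ρ, r ≠ 0 →
        ∀ᶠ p : ℝ × Y in 𝓝 (0, x), π (γ p.2 p.1) ≠ γ' (π p.2) r := by
      intro r hr hr0
      refine (isOpen_ne_fun (hπγ.comp continuous_swap)
        (hγ'.continuous_comp (hπ.1.comp continuous_snd) continuous_const)).mem_nhds ?_
      intro h
      simp only [Function.comp, Prod.swap, hγ.2.2.1] at h
      refine hr0 (huniq (π x) r hr 0 ⟨by linarith, hρ.le⟩ ?_)
      rw [hγ'.2.2.1, ← h]
    exact (key ρ ⟨by linarith, le_rfl⟩ hρ.ne').and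
      (key (-ρ) ⟨le_rfl, by linarith⟩ (by linarith))
  obtain ⟨η', hη', hend⟩ := Metric.eventually_nhds_iff.1 hend
  obtain ⟨η, hη, hηη'⟩ : ∃ η > 0, η < η' := ⟨η' / 2, by positivity, by linarith⟩
  have hend : ∀ t ∈ Icc (-η) η, ∀ y u, u ∈ Icc (-ρ) ρ → π (γ y t) = γ' (π y) u →
      u ∈ Ioo (-ρ) ρ := by
    intro t ht y u hu h
    have := hend (y := t) (by rw [Real.dist_eq, sub_zero, abs_lt]; constructor <;>
      linarith [ht.1, ht.2]) y (mem_univ y)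
    refine ⟨lt_of_le_of_ne hu.1 ?_, lt_of_le_of_ne hu.2 ?_⟩
    · rintro rfl; exact this.2 h
    · rintro rfl; exact this.1 h
  have hstep : ∀ y t u, u ∈ Ioo (-ρ) ρ → π (γ y t) = γ' (π y) u →
      ∀ᶠ s in 𝓝 t, ∃ v ∈ Ioo (-ρ) ρ, π (γ y s) = γ' (π y) v ∧ (t < s → u < v) := by
    intro y t u hu h
    obtain ⟨ε, hε, c, hc, hmono, hc0, hcπ⟩ := hπ.2.2 (γ y t)
    have hct : ContinuousAt (fun s => u + c (s - t)) t := by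
      refine continuousAt_const.add ?_
      have : ContinuousAt c (t - t) := by
        rw [sub_self]; exact hc.continuousAt (Ioo_mem_nhds (by linarith) hε)
      exact this.comp (f := fun s => s - t) (continuousAt_id.sub continuousAt_const)
    have h1 : ∀ᶠ s in 𝓝 t, u + c (s - t) ∈ Ioo (-ρ) ρ := by
      refine hct.eventually_mem (isOpen_Ioo.mem_nhds ?_)
      simpa [hc0] using hu
    have h2 : ∀ᶠ s in 𝓝 t, s ∈ Ioo (t - ε) (t + ε) := Ioo_mem_nhds (by linarith) (by linarith)
    filter_upwards [h1, h2] with s h1 h2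
    refine ⟨_, h1, ?_, fun hts => ?_⟩
    · rw [← hγ'.2.1, ← h, ← hcπ _ (by rw [abs_lt]; constructor <;> linarith [h2.1, h2.2]),
        hγ.2.1, add_sub_cancel]
    · have := hmono (a := 0) ⟨by linarith, hε⟩ (b := s - t)
        ⟨by linarith, by linarith [h2.2]⟩ (by linarith)
      linarith
  have hex : ∀ y, ∀ t ∈ Icc (-η) η, ∃ u ∈ Ioo (-ρ) ρ, π (γ y t) = γ' (π y) u := by
    intro y
    refine isPreconnected_Icc.subset_of_closure_inter_subset
      (u := {t | ∃ u ∈ Ioo (-ρ) ρ, π (γ y t) = γ' (π y) u}) ?_ ?_ ?_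
    · rw [isOpen_iff_mem_nhds]
      rintro t ⟨u, hu, h⟩
      filter_upwards [hstep y t u hu h] with s hs
      obtain ⟨v, hv, hv', -⟩ := hs
      exact ⟨v, hv, hv'⟩
    · exact ⟨0, ⟨by linarith, hη.le⟩, 0, ⟨by linarith, hρ⟩, by rw [hγ.2.2.1, hγ'.2.2.1]⟩
    · rintro t ⟨ht, htI⟩
      have hcl : IsClosed ((fun t => π (γ y t)) ⁻¹' (γ' (π y) '' Icc (-ρ) ρ)) :=
        (isCompact_Icc.image (hγ'.continuous_comp continuous_const continuous_id)).isClosed.preimage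
          (hπ.1.comp (hγ.continuous_comp continuous_const continuous_id))
      have hsub : {t | ∃ u ∈ Ioo (-ρ) ρ, π (γ y t) = γ' (π y) u} ⊆
          (fun t => π (γ y t)) ⁻¹' (γ' (π y) '' Icc (-ρ) ρ) := by
        rintro s ⟨u, hu, h⟩
        exact ⟨u, Ioo_subset_Icc_self hu, h.symm⟩
      obtain ⟨u, hu, h⟩ := closure_minimal hsub hcl ht
      exact ⟨u, hend t htI y u hu h.symm, h.symm⟩
  choose! c hcmem hc using hex
  have hcont : ContinuousOn (fun p : Y × ℝ => c p.1 p.2) (univ ×ˢ Icc (-η) η) := by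
    rintro ⟨x, t⟩ ⟨-, ht⟩
    rw [ContinuousWithinAt, tendsto_nhds]
    intro W hW hxW
    have hK : IsCompact (Icc (-ρ) ρ \ W) := isCompact_Icc.diff hW
    have h1 : ∀ᶠ p : Y × ℝ in 𝓝 (x, t), ∀ u ∈ Icc (-ρ) ρ \ W,
        π (γ p.1 p.2) ≠ γ' (π p.1) u := by
      refine hK.eventually_forall_of_forall_eventually fun u hu => ?_
      refine (isOpen_ne_fun (hπγ.comp continuous_fst) (hγ'.continuous_comp
        (hπ.1.comp (continuous_fst.comp continuous_fst)) continuous_snd)).mem_nhds ?_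
      intro h
      refine hu.2 ?_
      rw [huniq (π x) u hu.1 (c x t) (Ioo_subset_Icc_self (hcmem x t ht)) ?_]
      · exact hxW
      · rw [← hc x t ht]
        exact h.symm
    filter_upwards [mem_nhdsWithin_of_mem_nhds h1, self_mem_nhdsWithin] with p hp hp'
    by_contra hpW
    exact hp _ ⟨Ioo_subset_Icc_self (hcmem p.1 p.2 hp'.2), hpW⟩ (hc p.1 p.2 hp'.2)
  refine ⟨η, hη, c, hcont, fun y => ⟨?_, ?_, hc y⟩⟩
  · have h0 : (0 : ℝ) ∈ Icc (-η) η := ⟨by linarith, hη.le⟩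
    refine huniq (π y) _ (Ioo_subset_Icc_self (hcmem y 0 h0)) 0 ⟨by linarith, hρ.le⟩ ?_
    rw [← hc y 0 h0, hγ.2.2.1, hγ'.2.2.1]
  · refine ContinuousOn.strictMonoOn_Icc_of_eventually_nhdsGT ?_ fun t ht => ?_
    · exact hcont.comp (f := fun t => (y, t)) (by fun_prop) fun t ht => ⟨mem_univ _, ht⟩
    · have h1 : ∀ᶠ s in 𝓝[>] t, s ∈ Ioo t η := Ioo_mem_nhdsGT ht.2
      have htI := Ico_subset_Icc_self ht
      filter_upwards [h1, mem_nhdsWithin_of_mem_nhds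
        (hstep y t _ (hcmem y t htI) (hc y t htI))] with s hs hs'
      obtain ⟨v, hv, hv', hlt⟩ := hs'
      have hsI : s ∈ Icc (-η) η := ⟨ht.1.trans hs.1.le, hs.2.le⟩
      rw [huniq (π y) (c y s) (Ioo_subset_Icc_self (hcmem y s hsI)) v (Ioo_subset_Icc_self hv)
        (by rw [← hc y s hsI, hv'])]
      exact hlt hs.1

end FlowLemmas

/-- Proposition 2.11 of the paper, surjective case: for a surjective flow map `π` with
`C = π⁻¹(C')`, `C` is a cross section iff `C'` is a cross section. -/
theorem crossSection_iff_of_surjective_flowMap {Y Y' : Type*}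
    [MetricSpace Y] [CompactSpace Y] [MetricSpace Y'] [CompactSpace Y']
    (γ : Y → ℝ → Y) (γ' : Y' → ℝ → Y') (hγ : IsFlow γ) (hγ' : IsFlow γ')
    (π : Y → Y') (hπ : IsFlowMap γ γ' π) (hsurj : Function.Surjective π)
    (C : Set Y) (C' : Set Y') (hCC' : C = π ⁻¹' C') :
    IsCrossSection γ C ↔ IsCrossSection γ' C' := by
  subst hCC'
  have horb : ∀ y u, ∃ t, π (γ y t) = γ' (π y) u := fun y u => by
    have : γ' (π y) u ∈ π '' flowOrbit γ y := hπ.2.1 y ▸ mem_range_self u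
    obtain ⟨_, ⟨t, rfl⟩, h⟩ := this
    exact ⟨t, h⟩
  have horb' : ∀ y t, ∃ u, γ' (π y) u = π (γ y t) := fun y t => by
    have : π (γ y t) ∈ flowOrbit γ' (π y) := hπ.2.1 y ▸ mem_image_of_mem π (mem_range_self t)
    exact this
  have hback : ∀ y s, γ (γ y s) (-s) = y := fun y s => by
    rw [hγ.2.1, add_neg_cancel, hγ.2.2.1]
  have hback' : ∀ y s, γ' (γ' y s) (-s) = y := fun y s => by
    rw [hγ'.2.1, add_neg_cancel, hγ'.2.2.1]
  have hclosed : IsClosed (π ⁻¹' C') ↔ IsClosed C' :=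
    (hπ.1.isClosedMap.isQuotientMap hπ.1 hsurj).isClosed_preimage
  have hsurj_iff : Function.Surjective (fun p : (π ⁻¹' C' : Set Y) × ℝ => γ p.1.1 p.2) ↔
      Function.Surjective (fun p : C' × ℝ => γ' p.1.1 p.2) := by
    constructor
    · intro h y'
      obtain ⟨y, rfl⟩ := hsurj y'
      obtain ⟨⟨⟨z, hz⟩, t⟩, rfl⟩ := h y
      obtain ⟨u, hu⟩ := horb' z t
      exact ⟨(⟨π z, hz⟩, u), hu⟩
    · intro h y
      obtain ⟨⟨⟨z, hz⟩, t⟩, hzt⟩ := h (π y)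
      obtain ⟨s, hs⟩ := horb y (-t)
      refine ⟨(⟨γ y s, ?_⟩, -s), hback y s⟩
      rw [mem_preimage, hs, ← hzt]
      simpa only [hback'] using hz
  unfold IsCrossSection
  rw [hclosed, hsurj_iff]
  refine and_congr_right fun hC' => and_congr_right fun _ => ?_
  rw [hγ.isLocalHomeomorph_iff (hclosed.2 hC'), hγ'.isLocalHomeomorph_iff hC']
  obtain ⟨η, hη, c, hcont, hc⟩ := hπ.exists_time_change hγ hγ'
  have hcont0 : ∀ x, ∀ t ∈ Ioo (-η) η, ContinuousAt (fun p : Y × ℝ => c p.1 p.2) (x, t) :=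
    fun x t ht => hcont.continuousAt (prod_mem_nhds univ_mem (Icc_mem_nhds ht.1 ht.2))
  have h0 : (0 : ℝ) ∈ Icc (-η) η := ⟨by linarith, hη.le⟩
  have hsmall : ∀ ε > 0, ∀ x, ∀ᶠ p : Y × ℝ in 𝓝 (x, 0), |c p.1 p.2| < ε := by
    intro ε hε x
    refine (hcont0 x 0 ⟨by linarith, hη⟩).abs.eventually_lt continuousAt_const ?_
    simpa [(hc x).1] using hε
  -- every small time downstairs lifts to a small time upstairs
  have hlift : ∀ ε > 0, ∀ x, ∀ᶠ p : ℝ × Y in 𝓝 (0, x),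
      ∃ t, |t| < ε ∧ t ∈ Icc (-η) η ∧ c p.2 t = p.1 := by
    intro ε hε x
    obtain ⟨r, hr, hrε, hrη⟩ : ∃ r > 0, r < ε ∧ r < η :=
      ⟨min ε η / 2, by positivity, by linarith [min_le_left ε η, lt_min hε hη],
        by linarith [min_le_right ε η, lt_min hε hη]⟩
    have hr1 : r ∈ Icc (-η) η := ⟨by linarith, hrη.le⟩
    have hr2 : -r ∈ Icc (-η) η := ⟨by linarith, by linarith⟩
    have h1 : ∀ᶠ p : ℝ × Y in 𝓝 (0, x), p.1 < c p.2 r := by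
      refine continuous_fst.continuousAt.eventually_lt ?_ ?_
      · exact (hcont0 x r ⟨by linarith, hrη⟩).comp (f := fun p : ℝ × Y => (p.2, r))
          (x := (0, x)) (by fun_prop)
      · simpa [(hc x).1] using (hc x).2.1 h0 hr1 hr
    have h2 : ∀ᶠ p : ℝ × Y in 𝓝 (0, x), c p.2 (-r) < p.1 := by
      refine ContinuousAt.eventually_lt ?_ continuous_fst.continuousAt ?_
      · exact (hcont0 x (-r) ⟨by linarith, by linarith⟩).comp
          (f := fun p : ℝ × Y => (p.2, -r)) (x := (0, x)) (by fun_prop)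
      · simpa [(hc x).1] using (hc x).2.1 hr2 h0 (by linarith)
    filter_upwards [h1, h2] with p h1 h2
    have hcp : ContinuousOn (c p.2) (Icc (-r) r) :=
      hcont.comp (f := fun t => (p.2, t)) (by fun_prop)
        fun t ht => ⟨mem_univ _, by linarith [ht.1], by linarith [ht.2]⟩
    obtain ⟨t, ht, htp⟩ := intermediate_value_Icc (by linarith) hcp ⟨h2.le, h1.le⟩
    exact ⟨t, by rw [abs_lt]; constructor <;> linarith [ht.1, ht.2],
      ⟨by linarith [ht.1], by linarith [ht.2]⟩, htp⟩
  constructor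
  · rintro ⟨hsep, hnear⟩
    constructor
    · obtain ⟨ε, hε, hsep⟩ := Metric.eventually_nhds_iff.1 hsep
      have h1 : ∀ᶠ u in 𝓝 (0 : ℝ), ∀ y ∈ (univ : Set Y),
          ∃ t, |t| < ε ∧ t ∈ Icc (-η) η ∧ c y t = u :=
        isCompact_univ.eventually_forall_of_forall_eventually fun x _ => hlift ε hε x
      filter_upwards [h1] with u hu z hz hzu
      obtain ⟨y, rfl⟩ := hsurj z
      obtain ⟨t, htε, htη, rfl⟩ := hu y (mem_univ y)
      have : t = 0 := hsep (by simpa using htε) y hz (by rwa [mem_preimage, (hc y).2.2 t htη])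
      rw [this, (hc y).1]
    · intro x' hx' ε hε
      have key : ∀ x ∈ π ⁻¹' {x'}, ∀ᶠ y in 𝓝 x, ∃ u, |u| < ε ∧ γ' (π y) u ∈ C' := by
        intro x hx
        have h1 := hsmall ε hε x
        rw [nhds_prod_eq, eventually_prod_iff] at h1
        obtain ⟨P, hP, Q, hQ, hPQ⟩ := h1
        obtain ⟨δ, hδ, hQ⟩ := Metric.eventually_nhds_iff.1 hQ
        filter_upwards [hP, hnear x (by rwa [mem_preimage, show π x = x' from hx])
          (min δ η) (lt_min hδ hη)] with y hy hyt
        obtain ⟨t, ht, htC⟩ := hyt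
        obtain ⟨htδ, htη⟩ := lt_min_iff.1 ht
        refine ⟨c y t, hPQ hy (hQ (by simpa using htδ)), ?_⟩
        rw [← (hc y).2.2 t (abs_le.1 htη.le)]
        exact htC
      filter_upwards [hπ.1.isClosedMap.eventually_nhds_fiber x' key] with y' hy'
      obtain ⟨y, rfl⟩ := hsurj y'
      exact hy' y rfl
  · rintro ⟨hsep, hnear⟩
    constructor
    · obtain ⟨ε, hε, hsep⟩ := Metric.eventually_nhds_iff.1 hsep
      have h1 : ∀ᶠ t in 𝓝 (0 : ℝ), ∀ y ∈ (univ : Set Y), |c y t| < ε :=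
        isCompact_univ.eventually_forall_of_forall_eventually fun x _ =>
          (continuous_swap.tendsto ((0 : ℝ), x)).eventually (hsmall ε hε x)
      filter_upwards [h1, Icc_mem_nhds (neg_lt_zero.2 hη) hη] with t ht htη z hz hzt
      rw [mem_preimage, (hc z).2.2 t htη] at hzt
      have := hsep (by simpa using ht z (mem_univ z)) (π z) hz hzt
      exact (hc z).2.1.injOn htη h0 (this.trans (hc z).1.symm)
    · intro x hx ε hε
      have h1 := hlift ε hε x
      rw [nhds_prod_eq, eventually_prod_iff] at h1
      obtain ⟨P, hP, Q, hQ, hPQ⟩ := h1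
      obtain ⟨δ, hδ, hP⟩ := Metric.eventually_nhds_iff.1 hP
      filter_upwards [hQ, hπ.1.continuousAt.eventually (hnear (π x) hx δ hδ)] with y hy hyu
      obtain ⟨u, hu, huC⟩ := hyu
      obtain ⟨t, htε, htη, htu⟩ := hPQ (hP (by simpa using hu)) hy
      refine ⟨t, htε, ?_⟩
      rw [mem_preimage, (hc y).2.2 t htη, htu]
      exact huC
end

section
/- Suppose π : Y → Y' is a flow map (not necessarily surjective) between flows (Y,γ) and (Y',γ'), and C' ⊆ Y' is a cross section of the flow γ' on Y'. Then C = π⁻¹(C') is a cross section of the flow γ on Y. -/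
open Set Topology

/-- A function that is continuous and locally strictly increasing on a compact interval is strictly
increasing there. -/
theorem strictMonoOn_Icc_of_locally {g : ℝ → ℝ} {a b : ℝ} (hg : ContinuousOn g (Icc a b))
    (hloc : ∀ t ∈ Icc a b, ∃ ε > (0 : ℝ), StrictMonoOn (fun s => g (t + s)) (Ioo (-ε) ε)) :
    StrictMonoOn g (Icc a b) := by
  have hmono : ∀ x ∈ Icc a b, ∀ y ∈ Icc a b, x ≤ y → g x ≤ g y := by
    intro x hx y hy hxy
    have hsub : Icc x y ⊆ Icc a b := Icc_subset_Icc hx.1 hy.2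
    have hclosed : IsClosed ({t | g x ≤ g t} ∩ Icc x y) := by
      have := (hg.mono hsub).preimage_isClosed_of_isClosed isClosed_Icc (isClosed_Ici (a := g x))
      rwa [inter_comm] at this
    refine hclosed.Icc_subset_of_forall_mem_nhdsWithin (le_refl (g x)) ?_ (right_mem_Icc.2 hxy)
    rintro t ⟨ht, htxy⟩
    obtain ⟨ε, hε, hm⟩ := hloc t (hsub (Ico_subset_Icc_self htxy))
    filter_upwards [Ioo_mem_nhdsGT (show t < t + ε by linarith)] with u hu
    have h := hm (show (0 : ℝ) ∈ Ioo (-ε) ε by constructor <;> linarith)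
      (show u - t ∈ Ioo (-ε) ε by constructor <;> linarith [hu.1, hu.2]) (by linarith [hu.1])
    simp only [add_zero, add_sub_cancel] at h
    exact le_trans ht h.le
  intro x hx y hy hxy
  obtain ⟨ε, hε, hm⟩ := hloc x hx
  obtain ⟨u, hxu, hu⟩ := exists_between (show x < min y (x + ε) by
    rw [lt_min_iff]; constructor <;> linarith)
  rw [lt_min_iff] at hu
  have h := hm (show (0 : ℝ) ∈ Ioo (-ε) ε by constructor <;> linarith)
      (show u - x ∈ Ioo (-ε) ε by constructor <;> linarith) (by linarith)
  simp only [add_zero, add_sub_cancel] at h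
  exact h.trans_le (hmono u ⟨hx.1.trans hxu.le, hu.1.le.trans hy.2⟩ y hy hu.1.le)

section CrossSections

variable {Y Y' : Type*} [TopologicalSpace Y] [TopologicalSpace Y']

/-- Near a point of a cross section, the cross section is the zero set of a continuous function
that measures time along the flow. -/
theorem IsCrossSection.exists_local_time {γ : Y → ℝ → Y} (hγ : IsFlow γ) {C : Set Y}
    (hC : IsCrossSection γ C) {x : Y} (hx : x ∈ C) :
    ∃ V, IsOpen V ∧ x ∈ V ∧ ∃ τ : Y → ℝ, ContinuousOn τ V ∧ (∀ z ∈ V, z ∈ C ↔ τ z = 0) ∧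
      ∀ z ∈ V, ∀ᶠ s in 𝓝 (0 : ℝ), τ (γ z s) = τ z + s := by
  obtain ⟨-, hadd, hzero, -⟩ := hγ
  obtain ⟨e, hxe, he⟩ := hC.2.2 (⟨x, hx⟩, 0)
  have he' : ∀ p : C × ℝ, e p = γ p.1.1 p.2 := fun p => (congrFun he p).symm
  have htgt : e.target ∈ 𝓝 x := by
    have := e.open_target.mem_nhds (e.map_source hxe)
    rwa [he', hzero] at this
  have hsrc : ∀ᶠ y : C in 𝓝 ⟨x, hx⟩, (y, (0 : ℝ)) ∈ e.source :=
    (Continuous.prodMk_left (0 : ℝ)).continuousAt.eventually (e.open_source.mem_nhds hxe)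
  obtain ⟨u, hu, hsub⟩ := (mem_nhds_subtype _ _ _).1 hsrc
  have hV : interior (e.target ∩ u) ∈ 𝓝 x := interior_mem_nhds.2 (Filter.inter_mem htgt hu)
  refine ⟨interior (e.target ∩ u), isOpen_interior, mem_of_mem_nhds hV,
    fun z => (e.symm z).2, ?_, ?_, ?_⟩
  · exact continuous_snd.comp_continuousOn
      (e.continuousOn_symm.mono fun z hz => (interior_subset hz).1)
  · intro z hz
    obtain ⟨hzt, hzu⟩ := interior_subset hz
    constructor
    · intro hzC
      have hs : ((⟨z, hzC⟩ : C), (0 : ℝ)) ∈ e.source := hsub hzu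
      have h := e.left_inv hs
      rw [he', hzero] at h
      exact congrArg Prod.snd h
    · intro h
      have h2 := e.right_inv hzt
      rw [he', show (e.symm z).2 = 0 from h, hzero] at h2
      exact h2 ▸ (e.symm z).1.2
  · intro z hz
    have hzt := (interior_subset hz).1
    have hcont : ContinuousAt (fun s : ℝ => ((e.symm z).1, (e.symm z).2 + s)) 0 := by fun_prop
    have hmem : e.source ∈ 𝓝 ((e.symm z).1, (e.symm z).2 + (0 : ℝ)) := by
      rw [add_zero]
      exact e.open_source.mem_nhds (e.map_target hzt)
    filter_upwards [hcont.eventually hmem] with s hs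
    have h := e.left_inv hs
    have h2 := e.right_inv hzt
    rw [he'] at h h2
    simp only [← hadd] at h
    rw [h2] at h
    exact congrArg Prod.snd h

/-- Near a point of the preimage of a cross section under a flow map, the preimage is the zero set
of a continuous function that is locally strictly increasing along the flow. -/
theorem IsFlowMap.exists_local_height {γ : Y → ℝ → Y} {γ' : Y' → ℝ → Y'} (hγ' : IsFlow γ')
    {π : Y → Y'} (hπ : IsFlowMap γ γ' π) {C' : Set Y'} (hC' : IsCrossSection γ' C')
    {x : Y} (hx : x ∈ π ⁻¹' C') :
    ∃ W, IsOpen W ∧ x ∈ W ∧ ∃ f : Y → ℝ, ContinuousOn f W ∧ (∀ z ∈ W, z ∈ π ⁻¹' C' ↔ f z = 0) ∧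
      ∀ z ∈ W, ∃ ε > (0 : ℝ), StrictMonoOn (fun s => f (γ z s)) (Ioo (-ε) ε) := by
  obtain ⟨V, hVo, hxV, τ, hτ, hzero, hadd⟩ := hC'.exists_local_time hγ' hx
  refine ⟨π ⁻¹' V, hVo.preimage hπ.1, hxV, τ ∘ π,
    hτ.comp hπ.1.continuousOn fun _ h => h, fun z hz => hzero _ hz, fun z hz => ?_⟩
  obtain ⟨ε, hε, c, hc, hmono, hc0, hcz⟩ := hπ.2.2 z
  have hcont : ContinuousAt c 0 := hc.continuousAt (Ioo_mem_nhds (by linarith) hε)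
  have hev : ∀ᶠ t in 𝓝 (0 : ℝ), τ (γ' (π z) (c t)) = τ (π z) + c t :=
    hcont.eventually (by rw [hc0]; exact hadd _ hz)
  obtain ⟨δ, hδ, hball⟩ := Metric.eventually_nhds_iff.1 hev
  have key : ∀ t ∈ Ioo (-min ε δ) (min ε δ), t ∈ Ioo (-ε) ε ∧ (τ ∘ π) (γ z t) = τ (π z) + c t := by
    intro t ht
    have hlt := lt_min_iff.1 (abs_lt.2 ht)
    refine ⟨abs_lt.1 hlt.1, ?_⟩
    rw [Function.comp_apply, hcz t hlt.1]
    exact hball (by simpa using hlt.2)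
  refine ⟨min ε δ, lt_min hε hδ, fun s hs t ht hst => ?_⟩
  simp only [(key s hs).2, (key t ht).2]
  linarith [hmono (key s hs).1 (key t ht).1 hst]

/-- A set that is locally the zero set of a continuous function locally strictly increasing along
the flow is locally transverse to the flow. -/
theorem IsFlow.isLocalHomeomorph_of_local_height {γ : Y → ℝ → Y} (hγ : IsFlow γ) {C : Set Y}
    (hC : ∀ x ∈ C, ∃ W, IsOpen W ∧ x ∈ W ∧ ∃ f : Y → ℝ,
      ContinuousOn f W ∧ (∀ z ∈ W, z ∈ C ↔ f z = 0) ∧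
      ∀ z ∈ W, ∃ ε > (0 : ℝ), StrictMonoOn (fun s => f (γ z s)) (Ioo (-ε) ε)) :
    IsLocalHomeomorph (fun p : C × ℝ => γ p.1.1 p.2) := by
  obtain ⟨hcont, hadd, hzero, -⟩ := hγ
  have hF : Continuous (fun p : C × ℝ => γ p.1.1 p.2) :=
    hcont.comp ((continuous_subtype_val.comp continuous_fst).prodMk continuous_snd)
  have hflow : ∀ y, Continuous (γ y) :=
    fun y => hcont.comp (by fun_prop : Continuous fun t => (y, t))
  have htime : ∀ t, Continuous (fun y => γ y t) :=
    fun t => hcont.comp (by fun_prop : Continuous fun y => (y, t))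
  have hbox : ∀ x, ∀ N ∈ 𝓝 x, ∃ δ > (0 : ℝ), ∃ U ∈ 𝓝 x, ∀ y ∈ U, ∀ t, |t| ≤ δ → γ y t ∈ N := by
    intro x N hN
    have h : ∀ᶠ p : Y × ℝ in 𝓝 x ×ˢ 𝓝 0, γ p.1 p.2 ∈ N := by
      rw [← nhds_prod_eq]
      exact hcont.continuousAt.eventually (by beta_reduce; rwa [hzero])
    obtain ⟨U, hU, T, hT, hUT⟩ := Filter.mem_prod_iff.1 h
    obtain ⟨δ, hδ, hball⟩ := Metric.mem_nhds_iff.1 hT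
    refine ⟨δ / 2, by positivity, U, hU, fun y hy t ht => hUT (mk_mem_prod hy (hball ?_))⟩
    rw [Metric.mem_ball, Real.dist_eq, sub_zero]
    linarith
  have hmono : ∀ (W : Set Y) (f : Y → ℝ), ContinuousOn f W →
      (∀ z ∈ W, ∃ ε > (0 : ℝ), StrictMonoOn (fun s => f (γ z s)) (Ioo (-ε) ε)) →
      ∀ y δ, (∀ t, |t| ≤ δ → γ y t ∈ W) →
        ContinuousOn (fun t => f (γ y t)) (Icc (-δ) δ) ∧
        StrictMonoOn (fun t => f (γ y t)) (Icc (-δ) δ) := by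
    intro W f hf hloc y δ hy
    have hc : ContinuousOn (fun t => f (γ y t)) (Icc (-δ) δ) :=
      hf.comp (hflow y).continuousOn fun t ht => hy t (abs_le.2 ht)
    refine ⟨hc, strictMonoOn_Icc_of_locally hc fun t ht => ?_⟩
    simpa only [hadd] using hloc (γ y t) (hy t (abs_le.2 ht))
  have hopen : IsOpenMap (fun p : C × ℝ => γ p.1.1 p.2) := by
    refine IsOpenMap.of_nhds_le ?_
    rintro ⟨⟨x, hx⟩, t⟩ S hS
    obtain ⟨N, hN, T, hT, hNT⟩ := mem_nhds_prod_iff.1 (Filter.mem_map.1 hS)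
    obtain ⟨N₀, hN₀, hsub⟩ := (mem_nhds_subtype _ _ _).1 hN
    obtain ⟨η, hη, hball⟩ := Metric.mem_nhds_iff.1 hT
    obtain ⟨W, hWo, hxW, f, hf, hfC, hloc⟩ := hC x hx
    obtain ⟨δ₁, hδ₁, U, hU, hUW⟩ := hbox x (W ∩ N₀) (Filter.inter_mem (hWo.mem_nhds hxW) hN₀)
    obtain ⟨δ, hδ, hδlt⟩ := exists_between (lt_min hδ₁ hη)
    obtain ⟨hδδ₁, hδη⟩ := lt_min_iff.1 hδlt
    have hxm := hmono W f hf hloc x δ₁ fun s hs => (hUW x (mem_of_mem_nhds hU) s hs).1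
    have hfx : f (γ x 0) = 0 := by
      rw [hzero]
      exact (hfC x hxW).1 hx
    have h0 : (0 : ℝ) ∈ Icc (-δ₁) δ₁ := by constructor <;> linarith
    have hneg : f (γ x (-δ)) < 0 := hfx ▸
      hxm.2 (by constructor <;> linarith) h0 (by linarith)
    have hpos : 0 < f (γ x δ) := hfx ▸
      hxm.2 h0 (by constructor <;> linarith) (by linarith)
    have hcf : ∀ s, |s| < δ₁ → ContinuousAt (fun y => f (γ y s)) x := by
      intro s hs
      have hWs : W ∈ 𝓝 (γ x s) := hWo.mem_nhds (hUW x (mem_of_mem_nhds hU) s hs.le).1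
      exact ContinuousAt.comp (f := fun y => γ y s) (hf.continuousAt hWs) (htime s).continuousAt
    have hnhds : ∀ᶠ y in 𝓝 x, y ∈ U ∧ f (γ y (-δ)) < 0 ∧ 0 < f (γ y δ) :=
      Filter.Eventually.and hU
        (((hcf (-δ) (by rwa [abs_neg, abs_of_pos hδ])).eventually_lt_const hneg).and
          ((hcf δ (by rwa [abs_of_pos hδ])).eventually_const_lt hpos))
    have hback : Filter.Tendsto (fun y => γ y (-t)) (𝓝 (γ x t)) (𝓝 x) := by
      have := (htime (-t)).continuousAt (x := γ x t)
      rwa [ContinuousAt, hadd, add_neg_cancel, hzero] at this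
    filter_upwards [hback.eventually hnhds] with y hy
    obtain ⟨hyU, hyneg, hypos⟩ := hy
    have hyc := (hmono W f hf hloc (γ y (-t)) δ₁ fun s hs => (hUW _ hyU s hs).1).1
    obtain ⟨r, hr, hr0⟩ := intermediate_value_Icc (show -δ ≤ δ by linarith)
      (hyc.mono (Icc_subset_Icc (by linarith) hδδ₁.le)) ⟨hyneg.le, hypos.le⟩
    have hrU := hUW _ hyU r ((abs_le.2 hr).trans hδδ₁.le)
    have hrC : γ (γ y (-t)) r ∈ C := (hfC _ hrU.1).2 hr0
    have hmem : ((⟨_, hrC⟩ : C), t - r) ∈ N ×ˢ T := by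
      refine ⟨hsub hrU.2, hball ?_⟩
      rw [Metric.mem_ball, Real.dist_eq, show t - r - t = -r by ring, abs_neg]
      exact (abs_le.2 hr).trans_lt hδη
    have := hNT hmem
    simpa [hadd, hzero] using this
  have hinj : ∀ p : C × ℝ, ∃ s : Set (C × ℝ), IsOpen s ∧ p ∈ s ∧
      InjOn (fun p : C × ℝ => γ p.1.1 p.2) s := by
    rintro ⟨⟨x, hx⟩, t⟩
    obtain ⟨W, hWo, hxW, f, hf, hfC, hloc⟩ := hC x hx
    obtain ⟨δ, hδ, U, hU, hUW⟩ := hbox x W (hWo.mem_nhds hxW)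
    refine ⟨(Subtype.val ⁻¹' interior U) ×ˢ Metric.ball t (δ / 2),
      (isOpen_interior.preimage continuous_subtype_val).prod Metric.isOpen_ball,
      ⟨mem_interior_iff_mem_nhds.2 hU, Metric.mem_ball_self (by positivity)⟩, ?_⟩
    rintro ⟨⟨y, hy⟩, a⟩ ⟨hyU, ha⟩ ⟨⟨z, hz⟩, b⟩ ⟨hzU, hb⟩ hyz
    simp only at hyz
    have hyz' : γ y (a - b) = z := by
      have := congrArg (fun w => γ w (-b)) hyz
      simpa [hadd, hzero, sub_eq_add_neg] using this
    have hab : |a - b| ≤ δ := by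
      rw [← Real.dist_eq]
      have h1 := dist_triangle_right a b t
      rw [Metric.mem_ball] at ha hb
      linarith
    have hyW := hUW y (interior_subset hyU)
    have hm := (hmono W f hf hloc y δ hyW).2
    have hfy : f (γ y 0) = 0 := (hfC _ (hyW 0 (by simpa using hδ.le))).1 (by rwa [hzero])
    have hfz : f (γ y (a - b)) = 0 := (hfC _ (hyW _ hab)).1 (by rwa [hyz'])
    have hab0 : a - b = 0 := hm.injOn (abs_le.1 hab) (by constructor <;> linarith)
      (hfz.trans hfy.symm)
    rw [hab0, hzero] at hyz'
    subst hyz'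
    rw [sub_eq_zero.1 hab0]
  refine isLocalHomeomorph_iff_isOpenEmbedding_restrict.2 fun p => ?_
  obtain ⟨s, hs, hps, hinj⟩ := hinj p
  exact ⟨s, hs.mem_nhds hps, .of_continuous_injective_isOpenMap
    (hF.comp continuous_subtype_val) (injOn_iff_injective.1 hinj) (hopen.domRestrict hs)⟩

end CrossSections

/-- Proposition 2.11 of the paper, general case: the preimage of a cross section
under a (not necessarily surjective) flow map is a cross section. -/
theorem crossSection_preimage_of_flowMap {Y Y' : Type*}
    [MetricSpace Y] [CompactSpace Y] [MetricSpace Y'] [CompactSpace Y']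
    (γ : Y → ℝ → Y) (γ' : Y' → ℝ → Y') (hγ : IsFlow γ) (hγ' : IsFlow γ')
    (π : Y → Y') (hπ : IsFlowMap γ γ' π)
    (C' : Set Y') (hC' : IsCrossSection γ' C') :
    IsCrossSection γ (π ⁻¹' C') := by
  refine ⟨hC'.1.preimage hπ.1, fun y => ?_, hγ.isLocalHomeomorph_of_local_height
    fun x hx => hπ.exists_local_height hγ' hC' hx⟩
  obtain ⟨⟨⟨x', hx'⟩, t⟩, hxt⟩ := hC'.2.1 (π y)
  have hmem : x' ∈ flowOrbit γ' (π y) := by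
    refine ⟨-t, ?_⟩
    rw [← hxt, hγ'.2.1, add_neg_cancel, hγ'.2.2.1]
  rw [← hπ.2.1 y] at hmem
  obtain ⟨-, ⟨s, rfl⟩, hs⟩ := hmem
  refine ⟨(⟨γ y s, by rwa [mem_preimage, hs]⟩, -s), ?_⟩
  simp only [hγ.2.1, add_neg_cancel, hγ.2.2.1]
end

section
/- Suppose γ is a flow on a compact metric space Y which admits a totally disconnected cross section. Then every cross section of γ is totally disconnected. -/
open Set Topology

/-- In a locally compact Hausdorff space, a closed set that is locally totally disconnected is
totally disconnected. -/
theorem IsClosed.isTotallyDisconnected_of_local {X : Type*} [TopologicalSpace X] [T2Space X]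
    [LocallyCompactSpace X] {D : Set X} (hD : IsClosed D)
    (h : ∀ x ∈ D, ∃ U, IsOpen U ∧ x ∈ U ∧ IsTotallyDisconnected (D ∩ U)) :
    IsTotallyDisconnected D := by
  intro S hSD hS x hx y hy
  by_contra hxy
  obtain ⟨U, hUo, hxU, hU⟩ := h x (hSD hx)
  obtain ⟨N, hN, hNU, hNc⟩ := local_compact_nhds (hUo.mem_nhds hxU)
  have hK : IsCompact (D ∩ N) := hNc.inter_left hD
  have : CompactSpace ↥(D ∩ N) := isCompact_iff_compactSpace.mp hK
  have : TotallyDisconnectedSpace ↥(D ∩ N) :=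
    totallyDisconnectedSpace_subtype_iff.mpr
      fun T hT => hU T (hT.trans (inter_subset_inter_right D hNU))
  obtain ⟨V, hV, hxV, hVN⟩ := compact_exists_isClopen_in_isOpen
    (x := (⟨x, hSD hx, mem_of_mem_nhds hN⟩ : ↥(D ∩ N)))
    ((isOpen_interior.sdiff (isClosed_singleton (x := y))).preimage continuous_subtype_val)
    ⟨mem_interior_iff_mem_nhds.mpr hN, hxy⟩
  obtain ⟨O, hO, rfl⟩ := isOpen_induced_iff.mp hV.isOpen
  have hclosed : IsClosed (Subtype.val '' (Subtype.val ⁻¹' O : Set ↥(D ∩ N))) :=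
    hK.isClosed.isClosedMap_subtype_val _ hV.isClosed
  have hmem : ∀ z ∈ D, z ∈ O ∩ interior N →
      z ∈ Subtype.val '' (Subtype.val ⁻¹' O : Set ↥(D ∩ N)) :=
    fun z hzD hz => ⟨⟨z, hzD, interior_subset hz.2⟩, hz.1, rfl⟩
  obtain ⟨z, hzS, hzO, hzV⟩ := hS (O ∩ interior N) _ (hO.inter isOpen_interior)
    hclosed.isOpen_compl
    (fun z _ => by
      by_cases hz : z ∈ Subtype.val '' (Subtype.val ⁻¹' O : Set ↥(D ∩ N))
      · obtain ⟨w, hw, rfl⟩ := hz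
        exact Or.inl ⟨hw, (hVN hw).1⟩
      · exact Or.inr hz)
    ⟨x, hx, hxV, mem_interior_iff_mem_nhds.mpr hN⟩
    ⟨y, hy, by
      rintro ⟨w, hw, rfl⟩
      exact (hVN hw).2 rfl⟩
  exact hzV (hmem z (hSD hzS) hzO)

/-- A cross section contains no nontrivial flow segment. -/
theorem IsCrossSection.not_segment_subset {Y : Type*} [TopologicalSpace Y] {γ : Y → ℝ → Y}
    (hγ : IsFlow γ) {D : Set Y} (hD : IsCrossSection γ D) (y : Y) {a b : ℝ} (hab : a < b)
    (h : ∀ t ∈ Icc a b, γ y t ∈ D) : False := by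
  obtain ⟨hcont, hadd, hzero, -⟩ := hγ
  obtain ⟨e, he, hef⟩ := hD.2.2 (⟨γ y a, h a ⟨le_rfl, hab.le⟩⟩, 0)
  have hfun : ∀ p : D × ℝ, e p = γ p.1.1 p.2 := fun p => (congrFun hef p).symm
  have hcurve : Continuous fun t : Icc a b => ((⟨γ y t, h t t.2⟩ : D), (0 : ℝ)) :=
    ((hcont.comp (continuous_const.prodMk continuous_subtype_val)).subtype_mk _).prodMk
      continuous_const
  have hflow : Continuous fun t : Icc a b =>
      ((⟨γ y a, h a ⟨le_rfl, hab.le⟩⟩ : D), (t : ℝ) - a) :=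
    continuous_const.prodMk (continuous_subtype_val.sub continuous_const)
  have hopen := (e.open_source.preimage hcurve).inter (e.open_source.preimage hflow)
  obtain ⟨O, hO, hOeq⟩ := isOpen_induced_iff.mp hopen
  have haO : a ∈ O := by
    have : (⟨a, le_rfl, hab.le⟩ : Icc a b) ∈ (Subtype.val ⁻¹' O : Set (Icc a b)) := by
      rw [hOeq]
      exact ⟨he, by simpa using he⟩
    exact this
  have hev : ∀ᶠ t in 𝓝[>] a, t ∈ O ∧ t ∈ Ioc a b :=
    Filter.Eventually.and (mem_nhdsWithin_of_mem_nhds (hO.mem_nhds haO)) (Ioc_mem_nhdsGT hab)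
  obtain ⟨t, htO, hat, htb⟩ := hev.exists
  have ht : (⟨t, hat.le, htb⟩ : Icc a b) ∈ (Subtype.val ⁻¹' O : Set (Icc a b)) := htO
  rw [hOeq] at ht
  have heq := e.injOn ht.1 ht.2 (by simp [hfun, hzero, hadd])
  have : (0 : ℝ) = t - a := congrArg Prod.snd heq
  linarith

/-- If a flow admits a totally disconnected cross section, then every cross section
is totally disconnected (cf. Proposition 2.8 of the paper). -/
theorem crossSection_totallyDisconnected {Y : Type*} [MetricSpace Y] [CompactSpace Y]
    (γ : Y → ℝ → Y) (hγ : IsFlow γ)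
    (C : Set Y) (hC : IsCrossSection γ C) (hCtd : IsTotallyDisconnected C)
    (D : Set Y) (hD : IsCrossSection γ D) :
    IsTotallyDisconnected D := by
  refine hD.1.isTotallyDisconnected_of_local fun x _ => ?_
  obtain ⟨p, hp⟩ := hC.2.1 x
  obtain ⟨e, hpe, hef⟩ := hC.2.2 p
  have hfun : ∀ q : C × ℝ, e q = γ q.1.1 q.2 := fun q => (congrFun hef q).symm
  refine ⟨e.target, e.open_target, ?_, ?_⟩
  · have := e.map_source hpe
    rwa [hfun, show γ p.1.1 p.2 = x from hp] at this
  intro S hS hSc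
  have hT : IsPreconnected (e.symm '' S) :=
    hSc.image _ (e.continuousOn_symm.mono fun z hz => (hS hz).2)
  have : TotallyDisconnectedSpace C := totallyDisconnectedSpace_subtype_iff.mpr hCtd
  have hfst := (hT.image Prod.fst continuous_fst.continuousOn).subsingleton
  have hsnd := (hT.image Prod.snd continuous_snd.continuousOn).ordConnected
  have hle : ∀ q ∈ e.symm '' S, ∀ r ∈ e.symm '' S, r.2 ≤ q.2 := by
    intro q hq r hr
    by_contra! hlt
    refine hD.not_segment_subset hγ q.1 hlt fun t ht => ?_
    obtain ⟨w, hw, rfl⟩ := hsnd.out (mem_image_of_mem _ hq) (mem_image_of_mem _ hr) ht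
    rw [hfst (mem_image_of_mem _ hq) (mem_image_of_mem _ hw), ← hfun]
    obtain ⟨z, hz, rfl⟩ := hw
    rw [e.right_inv (hS hz).2]
    exact (hS hz).1
  intro a ha b hb
  have ha' := mem_image_of_mem e.symm ha
  have hb' := mem_image_of_mem e.symm hb
  exact e.symm.injOn (hS ha).2 (hS hb).2
    (Prod.ext (hfst (mem_image_of_mem _ ha') (mem_image_of_mem _ hb'))
      (le_antisymm (hle _ hb' _ ha') (hle _ ha' _ hb')))
end

section
/- Suppose γ is a flow on a compact metric space Y, C is a totally disconnected cross section of γ with return map ρ_C, and K is a closed subset of C. Then K is a cross section of the flow γ if and only if K is a discrete cross section for the homeomorphism ρ_C of C. -/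
open Set Topology

section CrossSection

variable {Y : Type*} [TopologicalSpace Y] {γ : Y → ℝ → Y} {C K : Set Y}

/-- Return times to a compact cross section are bounded away from zero. -/
theorem IsCrossSection.exists_pos_return_lower_bound [CompactSpace Y] (hγ : IsFlow γ)
    (hC : IsCrossSection γ C) :
    ∃ ε > (0 : ℝ), ∀ x ∈ C, ∀ t, |t| < ε → γ x t ∈ C → t = 0 := by
  have key : ∀ᶠ t in 𝓝 (0 : ℝ), ∀ x ∈ (univ : Set C), γ (x : Y) t ∈ C → t = 0 := by
    have : CompactSpace C := isCompact_iff_compactSpace.1 hC.1.isCompact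
    refine isCompact_univ.eventually_forall_of_forall_eventually fun x _ => ?_
    obtain ⟨e, hxe, he⟩ := hC.2.2 (x, 0)
    have hopen : e.source ∈ 𝓝 ((x, 0) : C × ℝ) := e.open_source.mem_nhds hxe
    obtain ⟨U, hU, V, hV, hUV⟩ := mem_nhds_prod_iff.1 hopen
    obtain ⟨U', hU', hU'U⟩ := mem_nhds_subtype C x U |>.1 hU
    have hcont : Filter.Tendsto (fun z : ℝ × C => γ (z.2 : Y) z.1) (𝓝 (0, x)) (𝓝 (x : Y)) := by
      have h : Continuous fun z : ℝ × C => γ (z.2 : Y) z.1 :=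
        hγ.1.comp ((continuous_subtype_val.comp continuous_snd).prodMk continuous_fst)
      simpa [hγ.2.2.1] using h.tendsto (0, x)
    filter_upwards [hcont hU', continuous_fst.tendsto (0, x) hV, continuous_snd.tendsto (0, x) hU]
      with z hz hzV hzU hzC
    have h₁ : (z.2, z.1) ∈ e.source := hUV ⟨hzU, hzV⟩
    have h₂ : ((⟨γ z.2 z.1, hzC⟩, 0) : C × ℝ) ∈ e.source :=
      hUV ⟨hU'U hz, mem_of_mem_nhds hV⟩
    have h := e.injOn h₁ h₂ (by rw [← he]; simp [hγ.2.2.1])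
    exact congrArg Prod.snd h
  obtain ⟨ε, hε, h⟩ := Metric.eventually_nhds_iff.1 key
  exact ⟨ε, hε, fun x hx t ht => h (by simpa using ht) ⟨x, hx⟩ (mem_univ _)⟩

/-- The points reached from a cross section within time `δ` form an open set. -/
theorem IsCrossSection.isOpen_flowBox (hC : IsCrossSection γ C) (δ : ℝ) :
    IsOpen {y | ∃ c ∈ C, ∃ s, |s| < δ ∧ γ c s = y} := by
  have h := hC.2.2.isOpenMap _ (isOpen_univ.prod (Metric.isOpen_ball (x := (0 : ℝ)) (ε := δ)))
  convert h using 1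
  ext y
  simp

/-- Every orbit meets a compact cross section within a uniformly bounded time. -/
theorem IsCrossSection.exists_uniform_hitting_time [CompactSpace Y] (hC : IsCrossSection γ C) :
    ∃ N : ℕ, ∀ y, ∃ c ∈ C, ∃ s, |s| < (N : ℝ) ∧ γ c s = y := by
  obtain ⟨N, hN⟩ := isCompact_univ.elim_directed_cover
    (fun n : ℕ => {y | ∃ c ∈ C, ∃ s, |s| < (n : ℝ) ∧ γ c s = y})
    (fun n => hC.isOpen_flowBox n)
    (fun y _ => by
      obtain ⟨p, hp⟩ := hC.2.1 y
      obtain ⟨n, hn⟩ := exists_nat_gt |p.2|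
      exact mem_iUnion.2 ⟨n, p.1, p.1.2, p.2, hn, hp⟩)
    (directed_of_isDirected_le fun m n hmn y => by
      rintro ⟨c, hc, s, hs, h⟩
      exact ⟨c, hc, s, hs.trans_le (by exact_mod_cast hmn), h⟩)
  exact ⟨N, fun y => hN (mem_univ y)⟩

/-- Every forward orbit meets a compact cross section. -/
theorem IsCrossSection.exists_forward_hit [CompactSpace Y] (hγ : IsFlow γ)
    (hC : IsCrossSection γ C) (y : Y) : ∃ t > 0, γ y t ∈ C := by
  obtain ⟨N, hN⟩ := hC.exists_uniform_hitting_time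
  obtain ⟨c, hc, s, hs, h⟩ := hN (γ y N)
  refine ⟨N - s, by linarith [le_abs_self s], ?_⟩
  rw [sub_eq_add_neg, ← hγ.2.1, ← h, hγ.2.1, add_neg_cancel, hγ.2.2.1]
  exact hc

/-- Every point lies on the forward orbit of a point of a compact cross section. -/
theorem IsCrossSection.exists_backward_hit [CompactSpace Y] (hγ : IsFlow γ)
    (hC : IsCrossSection γ C) (y : Y) : ∃ c ∈ C, ∃ t > 0, γ c t = y := by
  obtain ⟨N, hN⟩ := hC.exists_uniform_hitting_time
  obtain ⟨c, hc, s, hs, h⟩ := hN (γ y (-N))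
  refine ⟨c, hc, s + N, by linarith [neg_abs_le s], ?_⟩
  rw [← hγ.2.1, h, hγ.2.1, neg_add_cancel, hγ.2.2.1]

/-- The return time function of a compact cross section is continuous. -/
theorem IsCrossSection.continuous_returnTime [CompactSpace Y] (hγ : IsFlow γ)
    (hC : IsCrossSection γ C) {τ : C → ℝ}
    (hτ : ∀ x : C, IsLeast {t : ℝ | 0 < t ∧ γ (x : Y) t ∈ C} (τ x)) : Continuous τ := by
  obtain ⟨ε, hε, hmin⟩ := hC.exists_pos_return_lower_bound hγ
  refine continuous_iff_continuousAt.2 fun x => tendsto_order.2 ⟨fun a ha => ?_, fun b hb => ?_⟩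
  · have hev : ∀ᶠ x' : C in 𝓝 x, ∀ t ∈ Icc ε a, γ (x' : Y) t ∉ C := by
      refine isCompact_Icc.eventually_forall_of_forall_eventually fun t ht => ?_
      have hcont : Continuous fun z : C × ℝ => γ (z.1 : Y) z.2 :=
        hγ.1.comp ((continuous_subtype_val.comp continuous_fst).prodMk continuous_snd)
      refine (hC.1.isOpen_compl.preimage hcont).mem_nhds fun h => ?_
      exact absurd ((hτ x).2 ⟨hε.trans_le ht.1, h⟩) (by linarith [ht.2])
    filter_upwards [hev] with x' hx'
    by_contra! hle
    have hpos := (hτ x').1.1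
    refine hx' (τ x') ⟨?_, hle⟩ (hτ x').1.2
    by_contra! hlt
    exact hpos.ne' (hmin x' x'.2 _ (by rwa [abs_of_pos hpos]) (hτ x').1.2)
  · have hpos := (hτ x).1.1
    have hcont : Continuous fun x' : C => γ (x' : Y) (τ x) :=
      hγ.1.comp (continuous_subtype_val.prodMk continuous_const)
    have hδ : 0 < min (b - τ x) (τ x) := lt_min (by linarith) hpos
    filter_upwards [((hC.isOpen_flowBox (min (b - τ x) (τ x))).preimage hcont).mem_nhds
      ⟨_, (hτ x).1.2, 0, by simpa using hδ, hγ.2.2.1 _⟩] with x' ⟨c, hc, s, hs, h⟩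
    dsimp only at h
    have hs₁ := hs.trans_le (min_le_left _ _)
    have hs₂ := hs.trans_le (min_le_right _ _)
    have hmem : γ (x' : Y) (τ x - s) ∈ C := by
      rw [sub_eq_add_neg, ← hγ.2.1, ← h, hγ.2.1, add_neg_cancel, hγ.2.2.1]
      exact hc
    have := (hτ x').2 ⟨by linarith [le_abs_self s], hmem⟩
    linarith [neg_abs_le s]

/-- The return map of a compact cross section is continuous. -/
theorem IsCrossSection.continuous_returnMap [CompactSpace Y] (hγ : IsFlow γ)
    (hC : IsCrossSection γ C) {τ : C → ℝ}
    (hτ : ∀ x : C, IsLeast {t : ℝ | 0 < t ∧ γ (x : Y) t ∈ C} (τ x))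
    {ρ : C → C} (hρ : ∀ x : C, (ρ x : Y) = γ (x : Y) (τ x)) : Continuous ρ := by
  refine continuous_induced_rng.2 ?_
  have h : Subtype.val ∘ ρ = fun x : C => γ (x : Y) (τ x) := funext hρ
  rw [h]
  exact hγ.1.comp (continuous_subtype_val.prodMk (hC.continuous_returnTime hγ hτ))

/-- Iterates of the return map move points along their orbits. -/
theorem exists_flow_eq_iterate_returnMap (hγ : IsFlow γ) {τ : C → ℝ} {ρ : C → C}
    (hρ : ∀ x : C, (ρ x : Y) = γ (x : Y) (τ x)) (k : ℕ) (x : C) :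
    ∃ s, (ρ^[k] x : Y) = γ (x : Y) s := by
  induction k with
  | zero => exact ⟨0, (hγ.2.2.1 _).symm⟩
  | succ k ih =>
    obtain ⟨s, hs⟩ := ih
    exact ⟨s + τ (ρ^[k] x), by rw [Function.iterate_succ_apply', hρ, ← hγ.2.1, ← hs]⟩

/-- Every positive visit time to a compact cross section is reached by a positive number of
iterates of the return map. -/
theorem IsCrossSection.exists_iterate_returnMap_eq [CompactSpace Y] (hγ : IsFlow γ)
    (hC : IsCrossSection γ C) {τ : C → ℝ}
    (hτ : ∀ x : C, IsLeast {t : ℝ | 0 < t ∧ γ (x : Y) t ∈ C} (τ x))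
    {ρ : C → C} (hρ : ∀ x : C, (ρ x : Y) = γ (x : Y) (τ x))
    (x : C) {t : ℝ} (ht : 0 < t) (htC : γ (x : Y) t ∈ C) :
    ∃ k, 1 ≤ k ∧ (ρ^[k] x : Y) = γ (x : Y) t := by
  obtain ⟨ε, hε, hmin⟩ := hC.exists_pos_return_lower_bound hγ
  have hle : ∀ x, ε ≤ τ x := fun x => by
    by_contra! hlt
    have hpos := (hτ x).1.1
    exact hpos.ne' (hmin x x.2 _ (by rwa [abs_of_pos hpos]) (hτ x).1.2)
  obtain ⟨n, hn⟩ := exists_nat_gt (t / ε)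
  rw [div_lt_iff₀ hε] at hn
  induction n generalizing x t with
  | zero => simp at hn; linarith
  | succ n ih =>
    have hτt : τ x ≤ t := (hτ x).2 ⟨ht, htC⟩
    have hflow : γ (ρ x : Y) (t - τ x) = γ (x : Y) t := by
      rw [hρ, hγ.2.1, add_sub_cancel]
    rcases hτt.eq_or_lt with heq | hlt
    · exact ⟨1, le_rfl, by rw [Function.iterate_one, hρ, heq]⟩
    · obtain ⟨k, -, hk⟩ := ih (ρ x) (sub_pos.2 hlt) (hflow ▸ htC) (by
        have := hle x
        push_cast at hn
        linarith)
      exact ⟨k + 1, by omega, by rw [Function.iterate_succ_apply, hk, hflow]⟩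

/-- A cross section contained in a compact cross section is relatively open in it. -/
theorem IsCrossSection.isOpen_preimage_of_subset [CompactSpace Y] (hγ : IsFlow γ)
    (hC : IsCrossSection γ C) (hK : IsCrossSection γ K) (hKC : K ⊆ C) :
    IsOpen (Subtype.val ⁻¹' K : Set C) := by
  obtain ⟨ε, hε, hmin⟩ := hC.exists_pos_return_lower_bound hγ
  convert (hK.isOpen_flowBox ε).preimage (continuous_subtype_val (p := (· ∈ C))) using 1
  ext x
  constructor
  · exact fun hx => ⟨x, hx, 0, by simpa using hε, hγ.2.2.1 _⟩
  · rintro ⟨c, hc, s, hs, h⟩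
    have h0 := hmin c (hKC hc) s hs (h ▸ x.2)
    rw [h0, hγ.2.2.1] at h
    exact mem_preimage.2 (h ▸ hc)

/-- A relatively open subset of a cross section inherits the local product structure. -/
theorem IsCrossSection.isLocalHomeomorph_of_subset (hC : IsCrossSection γ C) (hKC : K ⊆ C)
    (hK : IsOpen (Subtype.val ⁻¹' K : Set C)) :
    IsLocalHomeomorph (fun p : K × ℝ => γ p.1.1 p.2) := by
  have hincl : IsOpenEmbedding (Set.inclusion hKC) :=
    ⟨IsEmbedding.inclusion hKC, by rw [Set.range_inclusion]; exact hK⟩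
  exact hC.2.2.comp (hincl.prodMap IsOpenEmbedding.id).isLocalHomeomorph

end CrossSection

/-- A discrete cross section for a continuous self-map of a compact Hausdorff space is open. -/
theorem IsDiscreteCrossSection.isOpen {Z : Type*} [TopologicalSpace Z] [CompactSpace Z]
    [T2Space Z] {T : Z → Z} {K : Set Z} (hT : Continuous T) (hK : IsDiscreteCrossSection T K) :
    IsOpen K := by
  obtain ⟨hcl, hmeet, r, hr, hmin⟩ := hK
  have : CompactSpace K := isCompact_iff_compactSpace.1 hcl.isCompact
  have hcompl : Kᶜ = ⋃ n ∈ range r, ⋃ i ∈ Ico 1 n, (fun x : K => T^[i] x) '' (r ⁻¹' {n}) := by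
    ext z
    simp only [mem_iUnion, exists_prop]
    constructor
    · intro hz
      have hex : ∃ k, ∃ x ∈ K, T^[k] x = z := by
        obtain ⟨x, hx, k, h⟩ := hmeet z
        exact ⟨k, x, hx, h⟩
      classical
      obtain ⟨x, hx, h⟩ := Nat.find_spec hex
      have hpos : 1 ≤ Nat.find hex := by
        by_contra! h0
        rw [Nat.lt_one_iff.1 h0] at h
        exact hz (h ▸ hx)
      have hlt : Nat.find hex < r ⟨x, hx⟩ := by
        by_contra! hge
        have hr1 := (hmin ⟨x, hx⟩).1
        refine Nat.find_min hex (m := Nat.find hex - r ⟨x, hx⟩) (by have := hr1.1; omega)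
          ⟨_, hr1.2, ?_⟩
        rw [← Function.iterate_add_apply, Nat.sub_add_cancel hge, h]
      exact ⟨_, ⟨⟨x, hx⟩, rfl⟩, _, ⟨hpos, hlt⟩, ⟨x, hx⟩, rfl, h⟩
    · rintro ⟨n, -, i, hi, x, hx, rfl⟩ hmem
      have := (hmin x).2 ⟨hi.1, hmem⟩
      rw [mem_preimage, mem_singleton_iff] at hx
      have := hi.2
      omega
  rw [← isClosed_compl_iff, hcompl]
  refine (isCompact_range hr).finite_of_discrete.isClosed_biUnion fun n _ => ?_
  refine (finite_Ico 1 n).isClosed_biUnion fun i _ => ?_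
  exact ((((isClosed_discrete ({n} : Set ℕ)).preimage hr).isCompact).image
    ((hT.iterate i).comp continuous_subtype_val)).isClosed

/-- For a continuous map, the return time to a clopen set is continuous. -/
theorem continuous_returnTime_of_isClopen {Z : Type*} [TopologicalSpace Z] {T : Z → Z} {K : Set Z}
    (hT : Continuous T) (hK : IsClopen K) {r : K → ℕ}
    (hr : ∀ x : K, IsLeast {k : ℕ | 1 ≤ k ∧ T^[k] (x : Z) ∈ K} (r x)) : Continuous r := by
  have hclopen : ∀ k, IsClopen {x : K | T^[k] (x : Z) ∈ K} := fun k =>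
    hK.preimage ((hT.iterate k).comp continuous_subtype_val)
  refine continuous_iff_continuousAt.2 fun x => ?_
  rw [ContinuousAt, nhds_discrete ℕ, Filter.tendsto_pure]
  have hbefore : ∀ᶠ x' : K in 𝓝 x, ∀ k ∈ Ico 1 (r x), T^[k] (x' : Z) ∉ K := by
    refine (Filter.eventually_all_finite (finite_Ico 1 (r x))).2 fun k hk => ?_
    refine (hclopen k).compl.isOpen.mem_nhds fun h => ?_
    exact absurd ((hr x).2 ⟨hk.1, h⟩) (not_le.2 hk.2)
  filter_upwards [(hclopen (r x)).isOpen.mem_nhds (hr x).1.2, hbefore] with x' hx' hlt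
  refine le_antisymm ((hr x').2 ⟨(hr x).1.1, hx'⟩) ?_
  by_contra! h
  exact hlt _ ⟨(hr x').1.1, h⟩ (hr x').1.2

/-- A closed subset `K` of a totally disconnected cross section `C` is a cross section of the
flow iff it is a discrete cross section for the return map `ρ_C`. -/
theorem crossSection_iff_discreteCrossSection {Y : Type*} [MetricSpace Y] [CompactSpace Y]
    (γ : Y → ℝ → Y) (hγ : IsFlow γ)
    (C : Set Y) (hC : IsCrossSection γ C) (hCtd : IsTotallyDisconnected C)
    (τC : C → ℝ) (hτC : ∀ x : C, IsLeast {t : ℝ | 0 < t ∧ γ (x : Y) t ∈ C} (τC x))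
    (ρC : C → C) (hρC : ∀ x : C, (ρC x : Y) = γ (x : Y) (τC x))
    (K : Set Y) (hKC : K ⊆ C) (hK : IsClosed K) :
    IsCrossSection γ K ↔ IsDiscreteCrossSection ρC (Subtype.val ⁻¹' K) := by
  have : CompactSpace C := isCompact_iff_compactSpace.1 hC.1.isCompact
  have hρ : Continuous ρC := hC.continuous_returnMap hγ hτC hρC
  have hclosed : IsClosed (Subtype.val ⁻¹' K : Set C) := hK.preimage continuous_subtype_val
  constructor
  · intro hKcs
    have hopen := hC.isOpen_preimage_of_subset hγ hKcs hKC
    have hret : ∀ x : (Subtype.val ⁻¹' K : Set C),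
        ∃ k, 1 ≤ k ∧ ρC^[k] (x : C) ∈ (Subtype.val ⁻¹' K : Set C) := fun x => by
      obtain ⟨t, ht, htK⟩ := hKcs.exists_forward_hit hγ (x : Y)
      obtain ⟨k, hk, h⟩ := hC.exists_iterate_returnMap_eq hγ hτC hρC x.1 ht (hKC htK)
      exact ⟨k, hk, mem_preimage.2 (h ▸ htK)⟩
    classical
    have hleast : ∀ x : (Subtype.val ⁻¹' K : Set C),
        IsLeast {k : ℕ | 1 ≤ k ∧ ρC^[k] (x : C) ∈ (Subtype.val ⁻¹' K : Set C)}
          (Nat.find (hret x)) := fun x =>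
      ⟨Nat.find_spec (hret x), fun k hk => Nat.find_min' (hret x) hk⟩
    refine ⟨hclosed, fun z => ?_, _,
      continuous_returnTime_of_isClopen hρ ⟨hclosed, hopen⟩ hleast, hleast⟩
    obtain ⟨c, hc, t, ht, h⟩ := hKcs.exists_backward_hit hγ (z : Y)
    obtain ⟨k, -, hk⟩ :=
      hC.exists_iterate_returnMap_eq hγ hτC hρC ⟨c, hKC hc⟩ ht (h ▸ z.2)
    exact ⟨⟨c, hKC hc⟩, hc, k, Subtype.ext (hk.trans h)⟩
  · intro hKd
    refine ⟨hK, fun y => ?_, hC.isLocalHomeomorph_of_subset hKC (hKd.isOpen hρ)⟩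
    obtain ⟨⟨c, t⟩, h⟩ := hC.2.1 y
    obtain ⟨x, hx, k, hk⟩ := hKd.2.1 c
    obtain ⟨s, hs⟩ := exists_flow_eq_iterate_returnMap hγ hρC k x
    refine ⟨(⟨x, hx⟩, s + t), ?_⟩
    simp only at h ⊢
    rw [← hγ.2.1, ← hs, hk, h]
end

section
/- Suppose γ is a flow on a compact metric space Y, h ∈ Homeo₊ᵒʳᵇ(Y), and β : Y → ℝ is a continuous function such that h(y) = γ(y, β(y)) for all y ∈ Y. For 0 ≤ s ≤ 1 define h_s : Y → Y by h_s(y) = γ(y, s·β(y)). Then each h_s belongs to Homeo₊ᵒʳᵇ(Y), the map (y,s) ↦ h_s(y) is continuous, h₀ = id and h₁ = h; in other words (h_s)_{0 ≤ s ≤ 1} is an isotopy in Homeo₊ᵒʳᵇ(Y) from the identity to h. -/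
open Set Topology

section FlowTimeChange

variable {Y : Type*} [TopologicalSpace Y] [CompactSpace Y] {γ : Y → ℝ → Y} {β : Y → ℝ}

theorem IsFlow.continuous_orbit {Y : Type*} [TopologicalSpace Y] {γ : Y → ℝ → Y}
    (hγ : IsFlow γ) (y : Y) : Continuous (γ y) :=
  hγ.1.comp (Continuous.prodMk_right y)

/-- The displacement is bounded, so the orbit parameter change is proper in both directions. -/
theorem tendsto_timeChange (hβ : Continuous β) (y : Y) :
    Filter.Tendsto (fun t => t + β (γ y t)) Filter.atTop Filter.atTop ∧
    Filter.Tendsto (fun t => t + β (γ y t)) Filter.atBot Filter.atBot := by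
  obtain ⟨M, hM⟩ := (isCompact_range hβ).isBounded.exists_norm_le
  have hb : ∀ t, |β (γ y t)| ≤ M := fun t => hM _ (mem_range_self _)
  exact ⟨Filter.tendsto_atTop_add_right_of_le _ (-M) Filter.tendsto_id
      fun t => (abs_le.1 (hb t)).1,
    Filter.tendsto_atBot_add_right_of_ge _ M Filter.tendsto_id fun t => (abs_le.1 (hb t)).2⟩

theorem IsFlow.surjective_timeChange (hγ : IsFlow γ) (hβ : Continuous β) (y : Y) :
    Function.Surjective (fun t => t + β (γ y t)) :=
  (continuous_id.add (hβ.comp (hγ.continuous_orbit y))).surjective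
    (tendsto_timeChange hβ y).1 (tendsto_timeChange hβ y).2

/-- If moving each point along its orbit by `β` is injective, then it is strictly increasing in
the orbit parameter. -/
theorem IsFlow.strictMono_timeChange (hγ : IsFlow γ) (hβ : Continuous β)
    (hinj : Function.Injective (fun y => γ y (β y))) (y : Y) :
    StrictMono (fun t => t + β (γ y t)) := by
  have hf_inj : Function.Injective (fun t => t + β (γ y t)) := by
    intro t u htu
    have h_eq : γ y t = γ y u := hinj (by simpa [hγ.2.1] using congrArg (γ y) htu)
    simpa [h_eq] using htu
  have hcont : Continuous (fun t => t + β (γ y t)) :=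
    continuous_id.add (hβ.comp (hγ.continuous_orbit y))
  refine (hcont.strictMono_of_inj hf_inj).resolve_right fun hanti => ?_
  obtain ⟨t, ht, ht0⟩ := (((tendsto_timeChange hβ y).1.eventually_gt_atTop
    (0 + β (γ y 0))).and (Filter.eventually_gt_atTop 0)).exists
  exact lt_asymm ht (hanti ht0)

theorem IsFlow.memHomeoPlusOrb_of_strictMono [T2Space Y] (hγ : IsFlow γ) (hβ : Continuous β)
    (hmono : ∀ y, StrictMono (fun t => t + β (γ y t))) :
    MemHomeoPlusOrb γ (fun y => γ y (β y)) := by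
  have hcont : Continuous (fun y => γ y (β y)) := hγ.1.comp (continuous_id.prodMk hβ)
  have hshift : ∀ y t, γ (γ y t) (β (γ y t)) = γ y (t + β (γ y t)) := fun y t => hγ.2.1 _ _ _
  have himage : ∀ y, (fun y => γ y (β y)) '' flowOrbit γ y = flowOrbit γ y := by
    intro y
    simp only [flowOrbit, ← range_comp]
    rw [← (hγ.surjective_timeChange hβ y).range_comp (γ y)]
    exact congrArg range (funext fun t => hshift y t)
  have horbit : ∀ y u, flowOrbit γ (γ y u) = flowOrbit γ y := by
    intro y u
    rw [flowOrbit, flowOrbit, ← (add_left_surjective u).range_comp (γ y)]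
    exact congrArg range (funext fun t => hγ.2.1 y u t)
  have hsurj : Function.Surjective (fun y => γ y (β y)) := by
    intro y
    obtain ⟨t, ht⟩ := hγ.surjective_timeChange hβ y 0
    refine ⟨γ y t, (hshift y t).trans ?_⟩
    rw [show t + β (γ y t) = 0 from ht, hγ.2.2.1]
  have hinj : Function.Injective (fun y => γ y (β y)) := by
    intro x z hxz
    have hxz : γ x (β x) = γ z (β z) := hxz
    have hz : z = γ x (β x - β z) := by
      rw [sub_eq_add_neg, ← hγ.2.1, hxz, hγ.2.1, add_neg_cancel, hγ.2.2.1]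
    obtain ⟨t, ht⟩ : ∃ t, z = γ x t := ⟨_, hz⟩
    have hperiod : γ x (t + β z - β x) = x := by
      rw [sub_eq_add_neg, ← hγ.2.1, ← hγ.2.1, ← ht, ← hxz, hγ.2.1, add_neg_cancel, hγ.2.2.1]
    have htime : t + β z - β x = t := by
      apply (hmono x).injective
      change t + β z - β x + β (γ x (t + β z - β x)) = t + β (γ x t)
      rw [hperiod, ← ht]
      ring
    rw [htime] at hperiod
    rw [ht, hperiod]
  refine ⟨⟨⟨hcont, fun y => (himage y).trans (horbit y _).symm, fun y => ?_⟩,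
    isHomeomorph_iff_continuous_bijective.2 ⟨hcont, hinj, hsurj⟩⟩, himage⟩
  refine ⟨1, one_pos, fun t => t + β (γ y t) - β y, ?_, ?_, ?_, ?_⟩
  · exact ((continuous_id.add (hβ.comp (hγ.continuous_orbit y))).sub
      continuous_const).continuousOn
  · exact fun a _ b _ hab => sub_lt_sub_right (hmono y hab) _
  · simp [hγ.2.2.1]
  · intro t _
    simp only [hγ.2.1]
    congr 1
    ring

end FlowTimeChange

/-- Theorem 3.3 (4) of the paper: if `h ∈ Homeo₊ᵒʳᵇ(Y)` satisfies `h y = γ y (β y)` for a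
continuous `β`, then `h_s : y ↦ γ y (s·β y)`, `0 ≤ s ≤ 1`, is an isotopy in `Homeo₊ᵒʳᵇ(Y)`
from the identity to `h`. -/
theorem isotopy_of_beta {Y : Type*} [MetricSpace Y] [CompactSpace Y]
    (γ : Y → ℝ → Y) (hγ : IsFlow γ) (h : Y → Y) (hh : MemHomeoPlusOrb γ h)
    (β : Y → ℝ) (hβ : Continuous β) (hhβ : ∀ y, h y = γ y (β y)) :
    Continuous (fun p : Y × ℝ => γ p.1 (p.2 * β p.1)) ∧
    (∀ s ∈ Set.Icc (0:ℝ) 1, MemHomeoPlusOrb γ (fun y => γ y (s * β y))) ∧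
    (∀ y, γ y ((0:ℝ) * β y) = y) ∧
    (∀ y, γ y ((1:ℝ) * β y) = h y) := by
  refine ⟨hγ.1.comp (continuous_fst.prodMk (continuous_snd.mul (hβ.comp continuous_fst))),
    fun s hs => ?_, fun y => by rw [zero_mul, hγ.2.2.1], fun y => by rw [one_mul, hhβ]⟩
  refine hγ.memHomeoPlusOrb_of_strictMono (continuous_const.mul hβ) fun y a b hab => ?_
  have hlt : a + β (γ y a) < b + β (γ y b) := hγ.strictMono_timeChange hβ
    (by simpa only [← hhβ] using hh.1.2.injective) y hab
  change a + s * β (γ y a) < b + s * β (γ y b)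
  rcases hs.2.lt_or_eq with hs1 | rfl
  · nlinarith [mul_le_mul_of_nonneg_left hlt.le hs.1, mul_lt_mul_of_pos_left hab (sub_pos.2 hs1)]
  · simpa using hlt
end

section
/- Suppose γ is a flow on a compact metric space Y, h ∈ Homeo₊ᵒʳᵇ(Y), and C and D are cross sections of γ with h(C) = D. Suppose there is a continuous map β : C → ℝ such that for all y ∈ C: (a) h(y) = γ(y, β(y)), and (b) β(ρ_C(y)) − β(y) = τ_D(h(y)) − τ_C(y). Then there is a continuous function β̃ : Y → ℝ extending β such that h(y) = γ(y, β̃(y)) for all y ∈ Y (and hence h ∈ Homeo₊ⁱˢᵒ(Y)). -/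
open Set Topology

section TimeLifts

variable {Y : Type*}

/-- `c` is a strictly increasing continuous time change on `s` along which the path `f` follows
the flow `γ`. -/
def IsTimeLiftOn (γ : Y → ℝ → Y) (f : ℝ → Y) (c : ℝ → ℝ) (s : Set ℝ) : Prop :=
  ContinuousOn c s ∧ StrictMonoOn c s ∧ ∀ t ∈ s, ∀ t' ∈ s, f t' = γ (f t) (c t' - c t)

theorem IsTimeLiftOn.mono {γ : Y → ℝ → Y} {f : ℝ → Y} {c : ℝ → ℝ} {s s' : Set ℝ}
    (hc : IsTimeLiftOn γ f c s) (hs : s' ⊆ s) : IsTimeLiftOn γ f c s' :=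
  ⟨hc.1.mono hs, hc.2.1.mono hs, fun t ht t' ht' => hc.2.2 t (hs ht) t' (hs ht')⟩

variable [TopologicalSpace Y]

theorem IsFlow.apply_neg_of_eq {γ : Y → ℝ → Y} (hγ : IsFlow γ) {x y : Y} {t : ℝ}
    (hxy : y = γ x t) : x = γ y (-t) := by
  rw [hxy, hγ.2.1, add_neg_cancel, hγ.2.2.1]

theorem IsFlow.isTimeLiftOn_of_base {γ : Y → ℝ → Y} (hγ : IsFlow γ) {f : ℝ → Y} {c : ℝ → ℝ}
    {s : Set ℝ} (hcont : ContinuousOn c s) (hmono : StrictMonoOn c s) (z : Y) (e : ℝ)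
    (hf : ∀ t ∈ s, f t = γ z (c t - e)) : IsTimeLiftOn γ f c s := by
  refine ⟨hcont, hmono, fun t ht t' ht' => ?_⟩
  rw [hf t ht, hf t' ht', hγ.2.1]
  congr 1
  ring

theorem IsFlow.isTimeLiftOn_glue {γ : Y → ℝ → Y} (hγ : IsFlow γ) {f : ℝ → Y} {c₁ c₂ : ℝ → ℝ}
    {a b d : ℝ} (hab : a ≤ b) (hbd : b ≤ d)
    (h₁ : IsTimeLiftOn γ f c₁ (Icc a b)) (h₂ : IsTimeLiftOn γ f c₂ (Icc b d)) :
    IsTimeLiftOn γ f (fun t => c₁ (min t b) - c₁ b + (c₂ (max t b) - c₂ b)) (Icc a d) := by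
  have m₁ : MapsTo (fun t => min t b) (Icc a d) (Icc a b) :=
    fun t ht => ⟨le_min ht.1 hab, min_le_right _ _⟩
  have m₂ : MapsTo (fun t => max t b) (Icc a d) (Icc b d) :=
    fun t ht => ⟨le_max_right _ _, max_le ht.2 hbd⟩
  have hb₁ : b ∈ Icc a b := ⟨hab, le_rfl⟩
  have hb₂ : b ∈ Icc b d := ⟨le_rfl, hbd⟩
  refine hγ.isTimeLiftOn_of_base ?_ ?_ (f b) 0 ?_
  · have k₁ : ContinuousOn (fun t => c₁ (min t b)) (Icc a d) :=
      h₁.1.comp (by fun_prop) m₁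
    have k₂ : ContinuousOn (fun t => c₂ (max t b)) (Icc a d) :=
      h₂.1.comp (by fun_prop) m₂
    exact (k₁.sub continuousOn_const).add (k₂.sub continuousOn_const)
  · intro s hs t ht hst
    have l₁ := h₁.2.1.monotoneOn (m₁ hs) (m₁ ht) (min_le_min_right b hst.le)
    have l₂ := h₂.2.1.monotoneOn (m₂ hs) (m₂ ht) (max_le_max_right b hst.le)
    simp only at l₁ l₂ ⊢
    rcases lt_or_ge s b with hsb | hsb
    · have := h₁.2.1 (m₁ hs) (m₁ ht) (by
        simp only [min_eq_left hsb.le]; exact lt_min hst hsb)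
      simp only at this
      linarith
    · have := h₂.2.1 (m₂ hs) (m₂ ht) (by
        simp only [max_eq_left hsb]; exact lt_max_of_lt_left hst)
      simp only at this
      linarith
  · intro t ht
    rcases le_total t b with htb | htb
    · rw [min_eq_left htb, max_eq_right htb, h₁.2.2 b hb₁ t ⟨ht.1, htb⟩]
      congr 1
      ring
    · rw [min_eq_right htb, max_eq_left htb, h₂.2.2 b hb₂ t ⟨htb, ht.2⟩]
      congr 1
      ring

theorem IsFlowMap.exists_isTimeLiftOn_nhds {γ : Y → ℝ → Y} (hγ : IsFlow γ) {h : Y → Y}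
    (hh : IsFlowMap γ γ h) (y : Y) (t₀ : ℝ) :
    ∃ ε > 0, ∃ c, IsTimeLiftOn γ (fun t => h (γ y t)) c (Ioo (t₀ - ε) (t₀ + ε)) := by
  obtain ⟨ε, hε, c, hc, hmono, -, hlift⟩ := hh.2.2 (γ y t₀)
  have m : MapsTo (fun t => t - t₀) (Ioo (t₀ - ε) (t₀ + ε)) (Ioo (-ε) ε) :=
    fun t ht => ⟨by linarith [ht.1], by linarith [ht.2]⟩
  refine ⟨ε, hε, fun t => c (t - t₀), hγ.isTimeLiftOn_of_base (hc.comp (by fun_prop) m)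
    (fun s hs t ht hst => hmono (m hs) (m ht) (by simpa using hst)) (h (γ y t₀)) 0 ?_⟩
  intro t ht
  have := hlift (t - t₀) (abs_lt.2 (m ht))
  rwa [hγ.2.1, add_sub_cancel, ← sub_zero (c _)] at this

theorem IsFlowMap.exists_isTimeLiftOn_Icc {γ : Y → ℝ → Y} (hγ : IsFlow γ) {h : Y → Y}
    (hh : IsFlowMap γ γ h) (y : Y) {a b : ℝ} (hab : a ≤ b) :
    ∃ c, IsTimeLiftOn γ (fun t => h (γ y t)) c (Icc a b) := by
  choose ε hε c hc using hh.exists_isTimeLiftOn_nhds hγ y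
  obtain ⟨t, ht0, htm, ⟨m, hm⟩, hsub⟩ := exists_monotone_Icc_subset_open_cover_Icc hab
    (c := fun t₀ : ℝ => Subtype.val ⁻¹' Ioo (t₀ - ε t₀) (t₀ + ε t₀))
    (fun t₀ => isOpen_Ioo.preimage continuous_subtype_val)
    (fun x _ => mem_iUnion.2 ⟨x, by simp [hε]⟩)
  have key : ∀ n, ∃ e, IsTimeLiftOn γ (fun t => h (γ y t)) e (Icc a (t n)) := by
    intro n
    induction n with
    | zero =>
      rw [ht0, Icc_self]
      refine ⟨id, continuousOn_id, strictMono_id.strictMonoOn _, ?_⟩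
      rintro _ rfl _ rfl
      simp [hγ.2.2.1]
    | succ n ih =>
      obtain ⟨e, he⟩ := ih
      obtain ⟨i, hi⟩ := hsub n
      refine ⟨_, hγ.isTimeLiftOn_glue (t n).2.1 (htm n.le_succ) he ((hc i).mono ?_)⟩
      intro s hs
      exact @hi ⟨s, (t n).2.1.trans hs.1, hs.2.trans (t (n + 1)).2.2⟩ hs
  have := key m
  rwa [hm m le_rfl] at this

theorem IsCrossSection.eq_of_flow_eq [T2Space Y] {γ : Y → ℝ → Y} {D : Set Y}
    (hD : IsCrossSection γ D) {z : Y} (hz : z ∈ D) {u v : ℝ → ℝ} (hu : Continuous u)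
    (hv : Continuous v) (huv : ∀ t, γ z (u t) = γ z (v t)) (t₀ : ℝ) (h₀ : u t₀ = v t₀) :
    u = v := by
  have := (T2Space.isSeparatedMap (fun p : D × ℝ => γ p.1.1 p.2)).eq_of_comp_eq
    hD.2.2.isLocallyInjective (g₁ := fun t : ℝ => ((⟨z, hz⟩ : D), u t))
    (g₂ := fun t : ℝ => ((⟨z, hz⟩ : D), v t)) (by fun_prop) (by fun_prop)
    (funext huv) t₀ (by simp [h₀])
  funext t
  exact congrArg Prod.snd (congrFun this t)

/-- A flow map has a global increasing time change along every orbit through a point which it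
sends to a cross section. -/
theorem IsFlowMap.exists_timeLift [T2Space Y] {γ : Y → ℝ → Y} (hγ : IsFlow γ) {h : Y → Y}
    (hh : IsFlowMap γ γ h) {D : Set Y} (hD : IsCrossSection γ D) {y : Y} (hy : h y ∈ D) :
    ∃ c : ℝ → ℝ, Continuous c ∧ StrictMono c ∧ c 0 = 0 ∧
      ∀ t, h (γ y t) = γ (h y) (c t) := by
  have hex : ∀ n : ℕ, ∃ c : ℝ → ℝ, ContinuousOn c (Icc (-(n : ℝ)) n) ∧
      StrictMonoOn c (Icc (-(n : ℝ)) n) ∧ c 0 = 0 ∧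
      ∀ t ∈ Icc (-(n : ℝ)) n, h (γ y t) = γ (h y) (c t) := by
    intro n
    have hn : (0 : ℝ) ≤ n := n.cast_nonneg
    obtain ⟨c, hc, hm, hl⟩ := hh.exists_isTimeLiftOn_Icc hγ y (neg_le_self hn)
    refine ⟨fun t => c t - c 0, by fun_prop, fun s hs t ht hst => ?_, sub_self _, fun t ht => ?_⟩
    · simpa using hm hs ht hst
    · simpa [hγ.2.2.1] using hl 0 ⟨neg_nonpos.2 hn, hn⟩ t ht
  choose c hc hm h0 hl using hex
  have agree : ∀ m n : ℕ, m ≤ n → EqOn (c m) (c n) (Icc (-(m : ℝ)) m) := by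
    intro m n hmn t ht
    have hmn' : (m : ℝ) ≤ n := by exact_mod_cast hmn
    have hsub : Icc (-(m : ℝ)) m ⊆ Icc (-(n : ℝ)) n := Icc_subset_Icc (by linarith) hmn'
    have h0m : (0 : ℝ) ∈ Icc (-(m : ℝ)) m := by simp
    have hmm : -(m : ℝ) ≤ m := by linarith [h0m.2]
    have := hD.eq_of_flow_eq hy (u := IccExtend hmm ((Icc (-(m : ℝ)) m).domRestrict (c m)))
      (v := IccExtend hmm ((Icc (-(m : ℝ)) m).domRestrict (c n)))
      (continuousOn_iff_continuous_domRestrict.1 (hc m)).Icc_extend'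
      (continuousOn_iff_continuous_domRestrict.1 ((hc n).mono hsub)).Icc_extend'
      (fun s => by
        have hs := (projIcc _ _ hmm s).2
        simp only [IccExtend, Function.comp_apply, domRestrict_apply]
        rw [← hl m _ hs, ← hl n _ (hsub hs)]) 0
      (by rw [IccExtend_of_mem _ _ h0m, IccExtend_of_mem _ _ h0m]; simp [h0])
    have := congrFun this t
    rwa [IccExtend_of_mem _ _ ht, IccExtend_of_mem _ _ ht] at this
  have heq : ∀ (n : ℕ) (t : ℝ), |t| ≤ n → c ⌈|t|⌉₊ t = c n t := fun n t ht =>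
    agree _ _ (Nat.ceil_le.2 ht) (abs_le.1 (Nat.le_ceil _))
  refine ⟨fun t => c ⌈|t|⌉₊ t, ?_, ?_, ?_, ?_⟩
  · refine continuous_iff_continuousAt.2 fun t₀ : ℝ => ?_
    obtain ⟨n, hn⟩ := exists_nat_gt |t₀|
    have hmem : ∀ᶠ t in 𝓝 t₀, |t| < (n : ℝ) := continuous_abs.continuousAt.eventually_lt_const hn
    have : ContinuousAt (c n) t₀ := (hc n).continuousAt
      (Icc_mem_nhds (abs_lt.1 hn).1 (abs_lt.1 hn).2)
    exact this.congr (hmem.mono fun t ht => (heq n t ht.le).symm)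
  · intro s t hst
    obtain ⟨n, hn⟩ := exists_nat_ge (max |s| |t|)
    have hs := (le_max_left _ _).trans hn
    have ht := (le_max_right _ _).trans hn
    simp only [heq n s hs, heq n t ht]
    exact hm n (abs_le.1 hs) (abs_le.1 ht) hst
  · simp [h0]
  · exact fun t => hl _ t (abs_le.1 (Nat.le_ceil _))

/-- Time changes along the orbits through a cross section depend continuously on the starting
point. -/
theorem IsCrossSection.continuous_timeLift [T2Space Y] {γ : Y → ℝ → Y} (hγ : IsFlow γ)
    {h : Y → Y} (hh : Continuous h) {C D : Set Y} (hD : IsCrossSection γ D)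
    (hCD : ∀ y ∈ C, h y ∈ D) {c : C → ℝ → ℝ} (hc : ∀ y, Continuous (c y))
    (hc0 : ∀ y, c y 0 = 0) (hl : ∀ (y : C) t, h (γ y t) = γ (h y) (c y t)) :
    Continuous (fun p : C × ℝ => c p.1 p.2) := by
  have hγc := hγ.1
  let f : C(unitInterval × (C × ℝ), Y) :=
    ⟨fun q => h (γ q.2.1 ((q.1 : ℝ) * q.2.2)), hh.comp (hγc.comp
      (f := fun q : unitInterval × (C × ℝ) => ((q.2.1 : Y), (q.1 : ℝ) * q.2.2)) (by fun_prop))⟩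
  have key := hD.2.2.continuous_lift (T2Space.isSeparatedMap _) f
    (g := fun q => ((⟨h q.2.1, hCD _ q.2.1.2⟩ : D), c q.2.1 ((q.1 : ℝ) * q.2.2)))
    (funext fun q => (hl q.2.1 _).symm)
    (by simp only [Icc.coe_zero, zero_mul, hc0]; fun_prop)
    (fun a => (continuous_const (y := (⟨h a.1, hCD _ a.1.2⟩ : D))).prodMk ((hc a.1).comp
      (f := fun s : unitInterval => (s : ℝ) * a.2) (by fun_prop)))
  have := continuous_snd.comp (key.comp (Continuous.prodMk_right (1 : unitInterval)))
  simpa [Function.comp_def] using this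

end TimeLifts

section Returns

variable {Y : Type*}

/-- An increasing time change carries first return times to first return times. -/
theorem isLeast_return_timeLift {γ : Y → ℝ → Y} {h : Y → Y} (hinj : Function.Injective h)
    {C D : Set Y} (hCD : h '' C = D) {y : Y} {τ : ℝ} (hτ : IsLeast {t : ℝ | 0 < t ∧ γ y t ∈ C} τ)
    {c : ℝ → ℝ} (hc : Continuous c) (hm : StrictMono c) (hc0 : c 0 = 0)
    (hl : ∀ t, h (γ y t) = γ (h y) (c t)) :
    IsLeast {t : ℝ | 0 < t ∧ γ (h y) t ∈ D} (c τ) := by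
  refine ⟨⟨hc0 ▸ hm hτ.1.1, hl τ ▸ hCD ▸ mem_image_of_mem h hτ.1.2⟩, fun r ⟨hr, hrD⟩ => ?_⟩
  by_contra! hlt
  obtain ⟨t, ht, rfl⟩ := intermediate_value_Ioo hτ.1.1.le hc.continuousOn
    ⟨hc0.trans_lt hr, hlt⟩
  rw [← hl, ← hCD, hinj.mem_set_image] at hrD
  exact (hτ.2 ⟨ht.1, hrD⟩).not_gt ht.2

variable [TopologicalSpace Y]

/-- Every visit of a forward orbit to a cross section is reached by finitely many first returns. -/
theorem IsCrossSection.return_induction {γ : Y → ℝ → Y} (hγ : IsFlow γ) {C : Set Y}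
    (hC : IsCrossSection γ C) {τ : C → ℝ}
    (hτ : ∀ x : C, IsLeast {t : ℝ | 0 < t ∧ γ (x : Y) t ∈ C} (τ x)) {y : Y} {P : ℝ → Prop}
    (hy : y ∈ C) (h0 : P 0) (hstep : ∀ s (hs : γ y s ∈ C), P s → P (s + τ ⟨γ y s, hs⟩))
    {s : ℝ} (hs0 : 0 ≤ s) (hs : γ y s ∈ C) : P s := by
  let next : {s : ℝ // γ y s ∈ C} → {s : ℝ // γ y s ∈ C} := fun s =>
    ⟨s + τ ⟨γ y s, s.2⟩, by rw [← hγ.2.1]; exact (hτ ⟨γ y s, s.2⟩).1.2⟩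
  let u : ℕ → {s : ℝ // γ y s ∈ C} := fun n => next^[n] ⟨0, by rwa [hγ.2.2.1]⟩
  have hu0 : (u 0 : ℝ) = 0 := rfl
  have husucc : ∀ n, (u (n + 1) : ℝ) = u n + τ ⟨γ y (u n), (u n).2⟩ := fun n => by
    simp only [u, Function.iterate_succ_apply']
    rfl
  have hmono : StrictMono (fun n => (u n : ℝ)) := strictMono_nat_of_lt_succ fun n => by
    rw [husucc]
    linarith [(hτ ⟨γ y (u n), (u n).2⟩).1.1]
  have hγy : Continuous (γ y) := hγ.1.comp (Continuous.prodMk_right y)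
  have hP : ∀ n, P (u n) := by
    intro n
    induction n with
    | zero => exact h0
    | succ n ih => rw [husucc]; exact hstep _ _ ih
  have htop : Filter.Tendsto (fun n => (u n : ℝ)) Filter.atTop Filter.atTop := by
    rcases tendsto_atTop_of_monotone hmono.monotone with hT | ⟨L, hL⟩
    · exact hT
    have hyL : Filter.Tendsto (fun n => γ y (u n)) Filter.atTop (𝓝 (γ y L)) :=
      (hγy.tendsto L).comp hL
    have hLC : γ y L ∈ C := hC.1.mem_of_tendsto hyL (.of_forall fun n => (u n).2)
    obtain ⟨U, hU, hmem, hinj⟩ := hC.2.2.isLocallyInjective ((⟨γ y L, hLC⟩ : C), (0 : ℝ))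
    have hlim : Filter.Tendsto (fun n => ((⟨γ y (u n), (u n).2⟩ : C), L - (u n : ℝ)))
        Filter.atTop (𝓝 ((⟨γ y L, hLC⟩ : C), (0 : ℝ))) := by
      refine Filter.Tendsto.prodMk_nhds (tendsto_subtype_rng.2 hyL) ?_
      simpa using hL.const_sub L
    obtain ⟨n, hn⟩ := (hlim.eventually (hU.mem_nhds hmem)).exists
    have := congrArg Prod.snd (hinj hn hmem (by simp [hγ.2.1]))
    have h1 : (u n : ℝ) < u (n + 1) := hmono n.lt_succ_self
    have h2 : (u (n + 1) : ℝ) ≤ L := hmono.monotone.ge_of_tendsto hL (n + 1)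
    simp only at this
    linarith
  have hex : ∃ n, s < u n := (htop.eventually_gt_atTop s).exists
  classical
  obtain ⟨n, hn⟩ : ∃ n, Nat.find hex = n + 1 := by
    refine Nat.exists_eq_succ_of_ne_zero fun h => ?_
    have := Nat.find_spec hex
    rw [h, hu0] at this
    linarith
  have hlt := Nat.find_spec hex
  have hle := not_lt.1 (Nat.find_min hex (m := n) (by omega))
  rw [hn, husucc] at hlt
  rcases hle.eq_or_lt with heq | hlt'
  · exact heq ▸ hP n
  · have := (hτ ⟨γ y (u n), (u n).2⟩).2
      (show s - u n ∈ _ from ⟨sub_pos.2 hlt', by simpa [hγ.2.1] using hs⟩)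
    linarith

end Returns

section Isotopy

variable {Y : Type*} [TopologicalSpace Y] [T2Space Y] [CompactSpace Y]

/-- Flowing for a time `b y` that is increasing along orbits, in the sense that
`t ↦ t + b (γ x t)` is, is a self flow equivalence. -/
theorem memHomeoPlus_of_strictMono {γ : Y → ℝ → Y} (hγ : IsFlow γ) {b : Y → ℝ}
    (hb : Continuous b) (hm : ∀ x, StrictMono (fun t => t + b (γ x t))) :
    MemHomeoPlus γ (fun y => γ y (b y)) := by
  obtain ⟨hcont, hadd, hzero, -⟩ := hγ
  have hγx : ∀ x, Continuous (γ x) := fun x => hcont.comp (Continuous.prodMk_right x)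
  have happ : ∀ x t, γ (γ x t) (b (γ x t)) = γ x (t + b (γ x t)) := fun x t => hadd _ _ _
  have hcu : ∀ x, Continuous (fun t => t + b (γ x t)) := fun x => by
    have := hγx x
    fun_prop
  obtain ⟨M, hM⟩ := isCompact_univ.exists_bound_of_continuousOn hb.continuousOn
  have hMb : ∀ y, -M ≤ b y ∧ b y ≤ M := fun y => abs_le.1 (hM y trivial)
  have hsurj : ∀ x, Function.Surjective (fun t => t + b (γ x t)) := fun x =>
    (hcu x).surjective
      (Filter.tendsto_atTop_mono (fun t => by simpa using (hMb (γ x t)).1)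
        (Filter.tendsto_atTop_add_const_right _ (-M) Filter.tendsto_id))
      (Filter.tendsto_atBot_mono (fun t => by simpa using (hMb (γ x t)).2)
        (Filter.tendsto_atBot_add_const_right _ M Filter.tendsto_id))
  have hch : Continuous (fun y => γ y (b y)) := hcont.comp (continuous_id.prodMk hb)
  refine ⟨⟨hch, fun y => ?_, fun y => ?_⟩,
    isHomeomorph_iff_continuous_bijective.2 ⟨hch, fun x x' hxx' => ?_, fun y => ?_⟩⟩
  · ext z
    simp only [flowOrbit, mem_image, mem_range, exists_exists_eq_and, happ]
    constructor
    · rintro ⟨t, rfl⟩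
      exact ⟨t + b (γ y t) - b y, by rw [hadd]; congr 1; ring⟩
    · rintro ⟨r, rfl⟩
      obtain ⟨t, ht⟩ := hsurj y (b y + r)
      exact ⟨t, by rw [hadd, ← ht]⟩
  · refine ⟨1, one_pos, fun t => t + b (γ y t) - b y, ((hcu y).sub continuous_const).continuousOn,
      fun s _ t _ hst => sub_lt_sub_right (hm y hst) _, by simp [hzero], fun t _ => ?_⟩
    simp only [happ, hadd]
    congr 1
    ring
  · simp only at hxx'
    set q := b x - b x' with hq
    have hx' : x' = γ x q := by
      have := congrArg (fun z => γ z (-b x')) hxx'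
      simp only [hadd, add_neg_cancel, hzero] at this
      rw [← this, hq, sub_eq_add_neg]
    have hq0 : b x = q + b (γ x q) := by rw [← hx', hq]; ring
    have := (hm x).injective (a₁ := 0) (a₂ := q) (by simpa [hzero] using hq0)
    rw [hx', ← this, hzero]
  · obtain ⟨t, ht⟩ := hsurj y 0
    exact ⟨γ y t, by simp only [happ, ht, hzero]⟩

theorem memHomeoPlusIso_of_strictMono {γ : Y → ℝ → Y} (hγ : IsFlow γ) {h : Y → Y}
    (hh : MemHomeoPlusOrb γ h) {b : Y → ℝ} (hb : Continuous b) (hhb : ∀ y, h y = γ y (b y))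
    (hm : ∀ x, StrictMono (fun t => t + b (γ x t))) : MemHomeoPlusIso γ h := by
  refine ⟨hh, fun y t => γ y (t * b y), ?_, fun t ht => ?_, fun y => ?_, fun y => ?_⟩
  · exact (hγ.1.comp (f := fun p : Y × ℝ => (p.1, p.2 * b p.1)) (by fun_prop)).continuousOn
  · refine memHomeoPlus_of_strictMono hγ (by fun_prop) fun x r s hrs => ?_
    have := hm x hrs
    simp only at this ⊢
    rcases ht.1.eq_or_lt with rfl | ht0
    · simpa using hrs
    · nlinarith [ht.2, mul_pos ht0 (sub_pos.2 this), mul_nonneg (sub_nonneg.2 ht.2)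
        (sub_pos.2 hrs).le]
  · simp [hγ.2.2.1]
  · simp [hhb]

end Isotopy

/-- Theorem 3.3 (3) of the paper: a time-change function `β` defined on a cross section `C`
with `h(C) = D` and compatible with return times extends to a continuous time-change
function on all of `Y`; hence `h ∈ Homeo₊ⁱˢᵒ(Y)`. -/
theorem beta_extension_of_crossSection {Y : Type*} [MetricSpace Y] [CompactSpace Y]
    (γ : Y → ℝ → Y) (hγ : IsFlow γ) (h : Y → Y) (hh : MemHomeoPlusOrb γ h)
    (C D : Set Y) (hC : IsCrossSection γ C) (hD : IsCrossSection γ D)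
    (hCD : h '' C = D)
    (τC : C → ℝ) (hτC : ∀ x : C, IsLeast {t : ℝ | 0 < t ∧ γ (x : Y) t ∈ C} (τC x))
    (τD : D → ℝ) (hτD : ∀ x : D, IsLeast {t : ℝ | 0 < t ∧ γ (x : Y) t ∈ D} (τD x))
    (ρC : C → C) (hρC : ∀ x : C, (ρC x : Y) = γ (x : Y) (τC x))
    (β : C → ℝ) (hβ : Continuous β)
    (ha : ∀ y : C, h (y : Y) = γ (y : Y) (β y))
    (hb : ∀ (y : C) (hy : h (y : Y) ∈ D), β (ρC y) - β y = τD ⟨h (y : Y), hy⟩ - τC y) :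
    ∃ βt : Y → ℝ, Continuous βt ∧ (∀ y : C, βt (y : Y) = β y) ∧
      (∀ y, h y = γ y (βt y)) ∧ MemHomeoPlusIso γ h := by
  obtain ⟨hcont, hadd, hzero, -⟩ := id hγ
  have hhD : ∀ y ∈ C, h y ∈ D := fun y hy => hCD ▸ mem_image_of_mem h hy
  choose c hc hm hc0 hl using fun y : C => hh.1.1.exists_timeLift hγ hD (hhD y y.2)
  have hτc : ∀ y : C, c y (τC y) = τD ⟨h y, hhD y y.2⟩ := fun y =>
    (isLeast_return_timeLift hh.1.2.injective hCD (hτC y) (hc y) (hm y) (hc0 y) (hl y)).unique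
      (hτD ⟨h y, hhD y y.2⟩)
  have hB : Continuous (fun p : C × ℝ => β p.1 + c p.1 p.2 - p.2) := by
    have := hD.continuous_timeLift hγ hh.1.1.1 hhD hc hc0 hl
    fun_prop
  have hcρ : ∀ (y : C) r, c (ρC y) r = c y (τC y + r) - c y (τC y) := fun y =>
    congrFun (hD.eq_of_flow_eq (hhD _ (ρC y).2) (hc _)
      (v := fun r => c y (τC y + r) - c y (τC y)) (by have := hc y; fun_prop)
      (fun r => by
        rw [← hl, hρC, hl y, hadd, hl y, hadd]
        congr 1
        ring) 0 (by simp [hc0]))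
  have hstep : ∀ (y : C) r, β (ρC y) + c (ρC y) r - r =
      β y + c y (τC y + r) - (τC y + r) := fun y r => by
    have := hb y (hhD y y.2)
    rw [← hτc] at this
    rw [hcρ]
    linarith
  have hreturn : ∀ (y : C) s, 0 ≤ s → ∀ (hs : γ y s ∈ C) r,
      β ⟨γ y s, hs⟩ + c ⟨γ y s, hs⟩ r - r = β y + c y (s + r) - (s + r) := by
    intro y s hs0 hs
    refine hC.return_induction hγ hτC y.2 (P := fun s => ∀ (hs : γ y s ∈ C) r,
      β ⟨γ y s, hs⟩ + c ⟨γ y s, hs⟩ r - r = β y + c y (s + r) - (s + r)) ?_ ?_ hs0 hs hs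
    · intro h0 r
      have : (⟨γ y 0, h0⟩ : C) = y := Subtype.ext (hzero y)
      rw [this, zero_add]
    · intro s hs ih hs' r
      have : (⟨γ y (s + τC ⟨γ y s, hs⟩), hs'⟩ : C) = ρC ⟨γ y s, hs⟩ :=
        Subtype.ext (by rw [hρC, hadd])
      rw [this, hstep, ih hs, add_assoc]
  have hle : ∀ (y y' : C) t t', t' ≤ t → γ y t = γ y' t' →
      β y + c y t - t = β y' + c y' t' - t' := by
    intro y y' t t' htt' heq
    have hy' : (y' : Y) = γ y (t - t') := by
      rw [hγ.apply_neg_of_eq heq, hadd, sub_eq_add_neg]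
    have hs : γ y (t - t') ∈ C := hy' ▸ y'.2
    have := hreturn y (t - t') (sub_nonneg.2 htt') hs t'
    rw [show (⟨γ y (t - t'), hs⟩ : C) = y' from Subtype.ext hy'.symm, sub_add_cancel] at this
    exact this.symm
  have hwd : ∀ (y y' : C) t t', γ y t = γ y' t' → β y + c y t - t = β y' + c y' t' - t' := by
    intro y y' t t' heq
    rcases le_total t' t with h | h
    · exact hle y y' t t' h heq
    · exact (hle y' y t' t h heq.symm).symm
  let βt : Y → ℝ := fun y =>
    β (Function.surjInv hC.2.1 y).1 + c (Function.surjInv hC.2.1 y).1 (Function.surjInv hC.2.1 y).2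
      - (Function.surjInv hC.2.1 y).2
  have hβt : ∀ (y : C) t, βt (γ y t) = β y + c y t - t := fun y t =>
    hwd _ _ _ _ (Function.surjInv_eq hC.2.1 (γ y t))
  have hβtc : Continuous βt :=
    (hC.2.2.isOpenMap.isQuotientMap hC.2.2.continuous hC.2.1).continuous_iff.2
      (hB.congr fun p => (hβt p.1 p.2).symm)
  have hhβ : ∀ y, h y = γ y (βt y) := fun y => by
    obtain ⟨⟨x, t⟩, rfl⟩ := hC.2.1 y
    simp only [hβt, hl, ha, hadd]
    congr 1
    ring
  refine ⟨βt, hβtc, fun y => ?_, hhβ, memHomeoPlusIso_of_strictMono hγ hh hβtc hhβ fun y => ?_⟩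
  · simpa [hzero, hc0] using hβt y 0
  · obtain ⟨⟨x, t₀⟩, rfl⟩ := hC.2.1 y
    intro r s hrs
    have := hm x (add_lt_add_right hrs t₀)
    simp only [hadd, hβt]
    linarith
end

section
/- Suppose γ is a flow on a compact metric space Y, C is a cross section of γ, and C' is a totally disconnected cross section of γ. Then for every ε > 0 there exists q ∈ Homeo₊ⁱˢᵒ(Y) with d(q(y), y) < ε for all y ∈ Y, such that: (1) there is a finite subset T ⊆ ℝ with q(C') ⊆ {γ(x,t) : x ∈ C, t ∈ T}; and (2) q(C') ∩ C = ∅. -/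
open Set Topology

/-- Displacing every point of a compact space along its orbit by a small amount `ψ`, Lipschitz
along orbits with a constant less than one, gives an element of `Homeo₊`. -/
lemma memHomeoPlus_of_displacement {Y : Type*} [MetricSpace Y] [CompactSpace Y]
    {γ : Y → ℝ → Y} (hγ : IsFlow γ) {ψ : Y → ℝ} (hψ : Continuous ψ) {δ ρ : ℝ}
    (hδ : ∀ y, |ψ y| ≤ δ) (hδρ : 2 * δ < ρ) (hρ : 0 < ρ)
    (hlip : ∀ y t, |t| < ρ → |ψ (γ y t) - ψ y| ≤ |t| / 2) :
    MemHomeoPlus γ (fun y => γ y (ψ y)) ∧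
      ∀ y, (fun y => γ y (ψ y)) '' flowOrbit γ y = flowOrbit γ y := by
  obtain ⟨hc, hadd, h0, -⟩ := hγ
  have hcont : Continuous (fun y => γ y (ψ y)) := hc.comp (continuous_id.prodMk hψ)
  have horb : ∀ y, (fun y => γ y (ψ y)) '' flowOrbit γ y = flowOrbit γ y := by
    intro y
    apply Subset.antisymm
    · rintro _ ⟨_, ⟨t, rfl⟩, rfl⟩
      exact ⟨t + ψ (γ y t), (hadd _ _ _).symm⟩
    · rintro _ ⟨t, rfl⟩
      have hg : Continuous (fun u => u + ψ (γ y u)) :=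
        continuous_id.add (hψ.comp (hc.comp (continuous_const.prodMk continuous_id)))
      obtain ⟨u, hu⟩ := mem_range_of_exists_le_of_exists_ge hg (c := t)
        ⟨t - δ, by linarith [(abs_le.1 (hδ (γ y (t - δ)))).2]⟩
        ⟨t + δ, by linarith [(abs_le.1 (hδ (γ y (t + δ)))).1]⟩
      refine ⟨γ y u, ⟨u, rfl⟩, ?_⟩
      simp only at hu ⊢
      rw [hadd, hu]
  have horb' : ∀ y s, flowOrbit γ (γ y s) = flowOrbit γ y := by
    intro y s
    apply Subset.antisymm
    · rintro _ ⟨t, rfl⟩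
      exact ⟨s + t, (hadd _ _ _).symm⟩
    · rintro _ ⟨t, rfl⟩
      exact ⟨t - s, by rw [hadd]; congr 1; ring⟩
  refine ⟨⟨⟨hcont, fun y => by rw [horb, horb'], fun y => ?_⟩, ?_⟩, horb⟩
  · refine ⟨ρ / 2, by linarith, fun t => t + ψ (γ y t) - ψ y, ?_, ?_, ?_, ?_⟩
    · exact ((continuous_id.add (hψ.comp
        (hc.comp (continuous_const.prodMk continuous_id)))).sub continuous_const).continuousOn
    · intro a ha b hb hab
      have h := hlip (γ y a) (b - a) (by
        rw [abs_lt]; constructor <;> linarith [ha.1, ha.2, hb.1, hb.2])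
      rw [hadd, add_sub_cancel, abs_of_pos (sub_pos.2 hab)] at h
      have := (abs_le.1 h).1
      simp only
      linarith
    · simp [h0]
    · intro t _
      simp only [hadd]
      congr 1
      ring
  · rw [isHomeomorph_iff_continuous_bijective]
    refine ⟨hcont, fun y z hyz => ?_, fun y => ?_⟩
    · simp only at hyz
      have hz : z = γ y (ψ y - ψ z) := by
        have := congrArg (fun w => γ w (-ψ z)) hyz
        simp only [hadd, add_neg_cancel, h0] at this
        rw [sub_eq_add_neg, this]
      have hsmall : |ψ y - ψ z| < ρ := by
        have h1 := abs_le.1 (hδ y)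
        have h2 := abs_le.1 (hδ z)
        rw [abs_lt]; constructor <;> linarith
      have h := hlip y _ hsmall
      rw [← hz, abs_sub_comm] at h
      have h3 : |ψ y - ψ z| = 0 := by linarith [abs_nonneg (ψ y - ψ z)]
      rw [hz, abs_eq_zero.1 h3, h0]
    · have hy : y ∈ flowOrbit γ y := ⟨0, h0 y⟩
      rw [← horb y] at hy
      obtain ⟨w, -, hw⟩ := hy
      exact ⟨w, hw⟩

lemma memHomeoPlusIso_of_displacement {Y : Type*} [MetricSpace Y] [CompactSpace Y]
    {γ : Y → ℝ → Y} (hγ : IsFlow γ) {ψ : Y → ℝ} (hψ : Continuous ψ) {δ ρ : ℝ}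
    (hδ : ∀ y, |ψ y| ≤ δ) (hδρ : 2 * δ < ρ) (hρ : 0 < ρ)
    (hlip : ∀ y t, |t| < ρ → |ψ (γ y t) - ψ y| ≤ |t| / 2) :
    MemHomeoPlusIso γ (fun y => γ y (ψ y)) := by
  refine ⟨memHomeoPlus_of_displacement hγ hψ hδ hδρ hρ hlip,
    fun y s => γ y (s * ψ y), ?_, ?_, ?_, ?_⟩
  · exact (hγ.1.comp (continuous_fst.prodMk
      (continuous_snd.mul (hψ.comp continuous_fst)))).continuousOn
  · intro s hs
    have key : ∀ a b : ℝ, |a| ≤ b → |s * a| ≤ b := fun a b hab => by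
      rw [abs_mul, abs_of_nonneg hs.1]
      exact (mul_le_of_le_one_left (abs_nonneg a) hs.2).trans hab
    refine (memHomeoPlus_of_displacement hγ (ψ := fun y => s * ψ y) (continuous_const.mul hψ)
      (fun y => key _ _ (hδ y)) hδρ hρ fun y t ht => ?_).1
    rw [← mul_sub]
    exact key _ _ (hlip y t ht)
  · intro y
    simp [hγ.2.2.1]
  · intro y
    simp

/-- Return times to a cross section of a flow on a compact space are bounded away from zero. -/
lemma IsCrossSection.exists_return_gap {Y : Type*} [MetricSpace Y] [CompactSpace Y]
    {γ : Y → ℝ → Y} (hγ : IsFlow γ) {C : Set Y} (hC : IsCrossSection γ C) :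
    ∃ η > 0, ∀ x ∈ C, ∀ t, |t| < η → γ x t ∈ C → t = 0 := by
  obtain ⟨hc, hadd, h0, -⟩ := hγ
  obtain ⟨hcl, -, hloc⟩ := hC
  have : CompactSpace C := isCompact_iff_compactSpace.1 hcl.isCompact
  have hev : ∀ᶠ t in 𝓝 (0 : ℝ), ∀ x ∈ (univ : Set C), γ x t ∈ C → t = 0 := by
    refine isCompact_univ.eventually_forall_of_forall_eventually fun x _ => ?_
    obtain ⟨e, hxe, he⟩ := hloc (x, 0)
    have hV : e.source ∈ 𝓝 (x, (0 : ℝ)) := e.open_source.mem_nhds hxe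
    have hV' : ∀ᶠ p : ℝ × C in 𝓝 (0, x), p.swap ∈ e.source := continuous_swap.continuousAt hV
    have hU : {z : C | (z, (0 : ℝ)) ∈ e.source} ∈ 𝓝 x :=
      (continuous_id.prodMk continuous_const).continuousAt hV
    obtain ⟨U, hU, hUsub⟩ := mem_nhds_subtype C x _ |>.1 hU
    have hU' : ∀ᶠ p : ℝ × C in 𝓝 (0, x), γ p.2 p.1 ∈ U := by
      have h1 : Continuous (fun p : ℝ × C => γ p.2 p.1) :=
        hc.comp ((continuous_subtype_val.comp continuous_snd).prodMk continuous_fst)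
      refine h1.continuousAt ?_
      simpa [h0] using hU
    filter_upwards [hV', hU'] with p hp hpU hpC
    have h2 : (⟨γ p.2 p.1, hpC⟩, (0 : ℝ)) ∈ e.source := hUsub (by exact hpU)
    have h3 := e.injOn hp h2 (by rw [← he]; simp [h0])
    exact congrArg Prod.snd h3
  obtain ⟨η, hη, h⟩ := Metric.eventually_nhds_iff.1 hev
  exact ⟨η, hη, fun x hx t ht => h (by simpa using ht) ⟨x, hx⟩ (mem_univ _)⟩

lemma exists_uniform_time {Y : Type*} [MetricSpace Y] [CompactSpace Y]
    {γ : Y → ℝ → Y} (hγ : IsFlow γ) {ε : ℝ} (hε : 0 < ε) :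
    ∃ η > 0, ∀ y t, |t| < η → dist (γ y t) y < ε := by
  have hev : ∀ᶠ t in 𝓝 (0 : ℝ), ∀ y ∈ (univ : Set Y), dist (γ y t) y < ε := by
    refine isCompact_univ.eventually_forall_of_forall_eventually fun y _ => ?_
    have h : Continuous (fun p : ℝ × Y => dist (γ p.2 p.1) p.2) :=
      (hγ.1.comp continuous_swap).dist continuous_snd
    refine h.continuousAt.eventually_lt continuousAt_const ?_
    simpa [hγ.2.2.1] using hε
  obtain ⟨η, hη, h⟩ := Metric.eventually_nhds_iff.1 hev
  exact ⟨η, hη, fun y t ht => h (by simpa using ht) y (mem_univ _)⟩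

lemma IsClopen.continuous_piecewise {X Z : Type*} [TopologicalSpace X] [TopologicalSpace Z]
    {V : Set X} (hV : IsClopen V) [∀ x, Decidable (x ∈ V)] {f g : X → Z}
    (hf : ContinuousOn f V) (hg : Continuous g) : Continuous (V.piecewise f g) :=
  _root_.continuous_piecewise (by simp [hV.frontier_eq])
    (by rwa [hV.isClosed.closure_eq]) hg.continuousOn

/-- A totally disconnected compact set can be moved by small continuous times along the flow
into finitely many translates of a cross section, avoiding the cross section itself. -/
lemma IsCrossSection.exists_small_time {Y : Type*} [MetricSpace Y] [CompactSpace Y]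
    {γ : Y → ℝ → Y} (hγ : IsFlow γ) {C K : Set Y} (hC : IsCrossSection γ C)
    (hK : IsClosed K) (hKtd : IsTotallyDisconnected K) {δ : ℝ} (hδ : 0 < δ) :
    ∃ φ : K → ℝ, Continuous φ ∧ ∃ T : Finset ℝ, ∀ z : K, |φ z| < δ ∧
      (∃ x ∈ C, ∃ t ∈ T, γ z (φ z) = γ x t) ∧ γ z (φ z) ∉ C := by
  classical
  obtain ⟨η, hη, hgap⟩ := hC.exists_return_gap hγ
  obtain ⟨hc, hadd, h0, -⟩ := hγ
  obtain ⟨hcl, hsurj, hloc⟩ := hC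
  have : CompactSpace K := isCompact_iff_compactSpace.1 hK.isCompact
  have : TotallyDisconnectedSpace K := totallyDisconnectedSpace_subtype_iff.2 hKtd
  have main : ∃ V : Set K, IsClopen V ∧ (univ : Set K) ⊆ V ∧ ∃ φ : K → ℝ, Continuous φ ∧
      ∃ T : Finset ℝ, ∀ z ∈ V, |φ z| < δ ∧
      (∃ x ∈ C, ∃ t ∈ T, γ z (φ z) = γ x t) ∧ γ z (φ z) ∉ C := by
    refine IsCompact.induction_on (isCompact_univ (X := K)) (p := fun S => ∃ V : Set K,
      IsClopen V ∧ S ⊆ V ∧ ∃ φ : K → ℝ, Continuous φ ∧ ∃ T : Finset ℝ, ∀ z ∈ V, |φ z| < δ ∧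
      (∃ x ∈ C, ∃ t ∈ T, γ z (φ z) = γ x t) ∧ γ z (φ z) ∉ C) ?_ ?_ ?_ ?_
    · exact ⟨∅, isClopen_empty, Subset.rfl, 0, continuous_zero, ∅, by simp⟩
    · rintro S S' hSS' ⟨V, hV, hSV, h⟩
      exact ⟨V, hV, hSS'.trans hSV, h⟩
    · rintro S S' ⟨V, hV, hSV, φ, hφ, T, h⟩ ⟨V', hV', hSV', φ', hφ', T', h'⟩
      refine ⟨V ∪ V', hV.union hV', union_subset_union hSV hSV', V.piecewise φ φ',
        hV.continuous_piecewise hφ.continuousOn hφ', T ∪ T', fun z hz => ?_⟩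
      by_cases hzV : z ∈ V
      · rw [piecewise_eq_of_mem _ _ _ hzV]
        obtain ⟨h1, ⟨x, hx, t, ht, hxt⟩, h3⟩ := h z hzV
        exact ⟨h1, ⟨x, hx, t, Finset.mem_union_left _ ht, hxt⟩, h3⟩
      · rw [piecewise_eq_of_notMem _ _ _ hzV]
        obtain ⟨h1, ⟨x, hx, t, ht, hxt⟩, h3⟩ := h' z (hz.resolve_left hzV)
        exact ⟨h1, ⟨x, hx, t, Finset.mem_union_right _ ht, hxt⟩, h3⟩
    · intro z _
      obtain ⟨⟨x, t⟩, hxt⟩ := hsurj z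
      obtain ⟨e, hxe, he⟩ := hloc (x, t)
      obtain ⟨s, hs, hsC⟩ : ∃ s, |s - t| < δ ∧ γ x s ∉ C := by
        by_cases h : γ x t ∈ C
        · have hm : 0 < min δ η := lt_min hδ hη
          have hm1 := min_le_left δ η
          have hm2 := min_le_right δ η
          have hpos : |min δ η / 2| = min δ η / 2 := abs_of_pos (by linarith)
          refine ⟨t + min δ η / 2, ?_, fun hh => ?_⟩
          · rw [add_sub_cancel_left, hpos]; linarith
          · rw [← hadd] at hh
            have := hgap _ h _ (by rw [hpos]; linarith) hh
            linarith
        · exact ⟨t, by simpa using hδ, h⟩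
      have hze : (z : Y) ∈ e.target := by
        have := e.map_source hxe
        rwa [← he, hxt] at this
      have hez : e.symm z = (x, t) := by
        rw [← hxt]
        have := e.left_inv hxe
        rwa [← he] at this
      have hright : ∀ y ∈ e.target, γ (e.symm y).1 (e.symm y).2 = y := fun y hy => by
        have := e.right_inv hy
        rwa [← he] at this
      have hcs : ContinuousAt (fun w : K => e.symm w) z :=
        ContinuousAt.comp (f := fun w : K => (w : Y)) (g := e.symm) (e.continuousAt_symm hze)
          continuous_subtype_val.continuousAt
      have hev : ∀ᶠ w : K in 𝓝 z, (w : Y) ∈ e.target ∧ |s - (e.symm w).2| < δ ∧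
          γ (e.symm w).1 s ∉ C := by
        refine Filter.Eventually.and ?_ (Filter.Eventually.and ?_ ?_)
        · exact continuous_subtype_val.continuousAt (e.open_target.mem_nhds hze)
        · have h1 : ContinuousAt (fun w : K => |s - (e.symm w).2|) z :=
            (continuousAt_const.sub (continuous_snd.continuousAt.comp hcs)).abs
          refine h1.eventually_lt continuousAt_const ?_
          simpa [hez] using hs
        · have h1 : Continuous (fun p : C × ℝ => γ p.1 s) :=
            hc.comp ((continuous_subtype_val.comp continuous_fst).prodMk continuous_const)
          have h2 : ContinuousAt (fun w : K => γ (e.symm w).1 s) z :=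
            h1.continuousAt.comp hcs
          refine h2 (hcl.isOpen_compl.mem_nhds ?_)
          simpa [hez] using hsC
      obtain ⟨W, hWsub, hWo, hzW⟩ := mem_nhds_iff.1 hev
      obtain ⟨V, hV, hzV, hVW⟩ := compact_exists_isClopen_in_isOpen hWo hzW
      refine ⟨V, mem_nhdsWithin_of_mem_nhds (hV.isOpen.mem_nhds hzV), V, hV, Subset.rfl,
        V.piecewise (fun w => s - (e.symm w).2) 0, hV.continuous_piecewise ?_ continuous_zero,
        {s}, fun w hw => ?_⟩
      · refine continuousOn_const.sub (continuous_snd.comp_continuousOn ?_)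
        exact e.continuousOn_symm.comp continuous_subtype_val.continuousOn
          fun w hw => (hWsub (hVW hw)).1
      · obtain ⟨h1, h2, h3⟩ := hWsub (hVW hw)
        rw [piecewise_eq_of_mem _ _ _ hw]
        have h4 : γ w (s - (e.symm w).2) = γ (e.symm w).1 s := by
          conv_lhs => rw [← hright w h1]
          rw [hadd, hright w h1, add_sub_cancel]
        rw [h4]
        exact ⟨h2, ⟨_, (e.symm w).1.2, s, by simp, rfl⟩, h3⟩
  obtain ⟨V, -, hV, φ, hφ, T, h⟩ := main
  exact ⟨φ, hφ, T, fun z => h z (hV (mem_univ z))⟩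

/-- A small continuous function on a cross section extends to a continuous function on the whole
space, supported near the cross section and Lipschitz along orbits. -/
lemma IsCrossSection.exists_extension {Y : Type*} [MetricSpace Y] [CompactSpace Y]
    {γ : Y → ℝ → Y} (hγ : IsFlow γ) {K : Set Y} (hK : IsCrossSection γ K) :
    ∃ ρ > 0, ∀ δ, 0 < δ → 2 * δ < ρ → ∀ φ : K → ℝ, Continuous φ → (∀ z, |φ z| ≤ δ) →
      ∃ ψ : Y → ℝ, Continuous ψ ∧ (∀ y, |ψ y| ≤ δ) ∧ (∀ z : K, ψ z = φ z) ∧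
        ∀ y t, |t| < ρ → |ψ (γ y t) - ψ y| ≤ |t| / 2 := by
  obtain ⟨η, hη, hgap⟩ := hK.exists_return_gap hγ
  obtain ⟨hc, hadd, h0, -⟩ := hγ
  obtain ⟨hcl, -, hloc⟩ := hK
  have : CompactSpace K := isCompact_iff_compactSpace.1 hcl.isCompact
  obtain ⟨ρ, hρ, hρη⟩ : ∃ ρ > 0, 4 * ρ = η := ⟨η / 4, by linarith, by ring⟩
  refine ⟨ρ, hρ, fun δ hδ hδρ φ hφ hφδ => ?_⟩
  let f : K × Ioo (-(2 * ρ)) (2 * ρ) → Y := fun p => γ p.1 p.2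
  have hfemb : IsOpenEmbedding f := by
    refine IsOpenEmbedding.of_continuous_injective_isOpenMap ?_ ?_ ?_
    · exact hc.comp ((continuous_subtype_val.comp continuous_fst).prodMk
        (continuous_subtype_val.comp continuous_snd))
    · rintro ⟨⟨x, hx⟩, ⟨u, hu⟩⟩ ⟨⟨x', hx'⟩, ⟨u', hu'⟩⟩ h
      simp only [f] at h
      have h1 : γ x (u - u') = x' := by
        have := congrArg (fun w => γ w (-u')) h
        simp only [hadd, add_neg_cancel, h0] at this
        rw [← this]; congr 1
      have h2 : u - u' = 0 := hgap x hx _ (by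
        rw [abs_lt]; constructor <;> linarith [hu.1, hu.2, hu'.1, hu'.2]) (h1 ▸ hx')
      rw [h2, h0] at h1
      have h3 : u = u' := by linarith
      subst h1 h3
      rfl
    · exact hloc.isOpenMap.comp
        (IsOpenMap.id.prodMap isOpen_Ioo.isOpenEmbedding_subtypeVal.isOpenMap)
  let b : ℝ → ℝ := fun u => max 0 (1 - |u| / ρ)
  have hb : Continuous b := continuous_const.max (continuous_const.sub
    (continuous_abs.div_const ρ))
  have hb0 : ∀ u, 0 ≤ b u := fun u => le_max_left _ _
  have hb1 : ∀ u, b u ≤ 1 := fun u => max_le zero_le_one (by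
    have : 0 ≤ |u| / ρ := by positivity
    linarith)
  have hbz : ∀ u, ρ ≤ |u| → b u = 0 := fun u hu => max_eq_left (by
    have : 1 ≤ |u| / ρ := (one_le_div hρ).2 hu
    linarith)
  have hblip : ∀ u v, |b u - b v| ≤ |u - v| / ρ := fun u v => by
    have h1 := abs_max_sub_max_le_max 0 (1 - |u| / ρ) 0 (1 - |v| / ρ)
    have h2 : |(1 - |u| / ρ) - (1 - |v| / ρ)| ≤ |u - v| / ρ := by
      rw [show (1 - |u| / ρ) - (1 - |v| / ρ) = (|v| - |u|) / ρ by ring, abs_div,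
        abs_of_pos hρ, abs_sub_comm u v]
      exact div_le_div_of_nonneg_right (abs_abs_sub_abs_le_abs_sub v u) hρ.le
    refine h1.trans (max_le ?_ h2)
    rw [sub_self, abs_zero]; positivity
  let g : K × Ioo (-(2 * ρ)) (2 * ρ) → ℝ := fun p => b p.2 * φ p.1
  have hg : Continuous g := (hb.comp (continuous_subtype_val.comp continuous_snd)).mul
    (hφ.comp continuous_fst)
  let ψ : Y → ℝ := Function.extend f g 0
  have hψf : ∀ p, ψ (f p) = g p := fun p => hfemb.injective.extend_apply _ _ _
  have hψ : ∀ (x : K) u, |u| < 2 * ρ → ψ (γ x u) = b u * φ x := fun x u hu =>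
    hψf (x, ⟨u, abs_lt.1 hu⟩)
  have hψ0 : ∀ y, (¬ ∃ (x : K) (u : ℝ), |u| ≤ ρ ∧ γ x u = y) → ψ y = 0 := fun y hy => by
    by_cases hr : ∃ p, f p = y
    · obtain ⟨p, rfl⟩ := hr
      rw [hψf]
      simp only [g]
      rw [hbz _ (not_lt.1 fun h => hy ⟨p.1, p.2, h.le, rfl⟩), zero_mul]
    · exact Function.extend_apply' _ _ _ hr
  have hlip : ∀ (x : K) u v, |u| < 2 * ρ → |v| < 2 * ρ →
      |ψ (γ x u) - ψ (γ x v)| ≤ |u - v| / 2 := fun x u v hu hv => by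
    rw [hψ x u hu, hψ x v hv, ← sub_mul, abs_mul]
    calc |b u - b v| * |φ x| ≤ (|u - v| / ρ) * (ρ / 2) := by
          gcongr
          · exact hblip u v
          · linarith [hφδ x]
      _ = |u - v| / 2 := by field_simp
  refine ⟨ψ, ?_, fun y => ?_, fun z => ?_, fun y t ht => ?_⟩
  · rw [continuous_iff_continuousAt]
    intro y
    by_cases hr : ∃ p, f p = y
    · obtain ⟨p, rfl⟩ := hr
      rw [← hfemb.continuousAt_iff]
      exact hg.continuousAt.congr (Filter.Eventually.of_forall fun p => (hψf p).symm)
    · have hcomp : IsCompact ((fun p : K × ℝ => γ p.1 p.2) '' (univ ×ˢ Icc (-ρ) ρ)) :=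
        (isCompact_univ.prod isCompact_Icc).image
          (hc.comp ((continuous_subtype_val.comp continuous_fst).prodMk continuous_snd))
      have hnot : y ∈ ((fun p : K × ℝ => γ p.1 p.2) '' (univ ×ˢ Icc (-ρ) ρ))ᶜ := by
        rintro ⟨⟨x, u⟩, ⟨-, hu⟩, rfl⟩
        exact hr ⟨(x, ⟨u, by linarith [hu.1], by linarith [hu.2]⟩), rfl⟩
      refine (continuousAt_const (y := (0 : ℝ))).congr ?_
      filter_upwards [hcomp.isClosed.isOpen_compl.mem_nhds hnot] with w hw
      refine (hψ0 w ?_).symm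
      rintro ⟨x, u, hu, rfl⟩
      exact hw ⟨(x, u), ⟨mem_univ _, abs_le.1 hu⟩, rfl⟩
  · by_cases hr : ∃ p, f p = y
    · obtain ⟨p, rfl⟩ := hr
      rw [hψf, abs_mul, abs_of_nonneg (hb0 _)]
      exact (mul_le_of_le_one_left (abs_nonneg _) (hb1 _)).trans (hφδ _)
    · have h : ψ y = 0 := Function.extend_apply' _ _ _ hr
      rw [h, abs_zero]; exact hδ.le
  · have := hψ z 0 (by simpa using hρ)
    rw [h0] at this
    rw [this]
    simp [b]
  · rw [abs_lt] at ht
    by_cases hy : ∃ (x : K) (u : ℝ), |u| ≤ ρ ∧ γ x u = y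
    · obtain ⟨x, u, hu, rfl⟩ := hy
      rw [abs_le] at hu
      rw [hadd]
      refine (hlip x (u + t) u ?_ ?_).trans (by rw [add_sub_cancel_left]) <;>
        rw [abs_lt] <;> constructor <;> linarith [hu.1, hu.2, ht.1, ht.2]
    · by_cases hyt : ∃ (x : K) (u : ℝ), |u| ≤ ρ ∧ γ x u = γ y t
      · obtain ⟨x, u, hu, hxu⟩ := hyt
        rw [abs_le] at hu
        have hyx : y = γ x (u - t) := by
          have := congrArg (fun w => γ w (-t)) hxu
          simp only [hadd, add_neg_cancel, h0] at this
          rw [← this]; congr 1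
        rw [← hxu, hyx]
        refine (hlip x u (u - t) ?_ ?_).trans (by rw [sub_sub_cancel]) <;>
          rw [abs_lt] <;> constructor <;> linarith [hu.1, hu.2, ht.1, ht.2]
      · rw [hψ0 _ hy, hψ0 _ hyt, sub_self, abs_zero]
        positivity

/-- Lemma 4.1 of the paper: given cross sections `C` and `C'` with `C'` totally disconnected,
there is a `q ∈ Homeo₊ⁱˢᵒ(Y)` arbitrarily close to the identity moving `C'` into finitely
many time-translates of `C` and off of `C`. -/
theorem disjointify {Y : Type*} [MetricSpace Y] [CompactSpace Y]
    (γ : Y → ℝ → Y) (hγ : IsFlow γ)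
    (C C' : Set Y) (hC : IsCrossSection γ C) (hC' : IsCrossSection γ C')
    (hC'td : IsTotallyDisconnected C') (ε : ℝ) (hε : 0 < ε) :
    ∃ q : Y → Y, MemHomeoPlusIso γ q ∧ (∀ y, dist (q y) y < ε) ∧
      (∃ T : Finset ℝ, q '' C' ⊆ {y | ∃ x ∈ C, ∃ t ∈ T, y = γ x t}) ∧
      (q '' C') ∩ C = ∅ := by
  obtain ⟨ρ, hρ, hext⟩ := hC'.exists_extension hγ
  obtain ⟨η, hη, hdist⟩ := exists_uniform_time hγ hε
  obtain ⟨δ, hδ, hδ1⟩ := exists_between (lt_min (half_pos hρ) hη)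
  obtain ⟨hδρ, hδη⟩ := lt_min_iff.1 hδ1
  obtain ⟨φ, hφ, T, hT⟩ := hC.exists_small_time hγ hC'.1 hC'td hδ
  obtain ⟨ψ, hψ, hψδ, hψφ, hlip⟩ := hext δ hδ (by linarith) φ hφ fun z => (hT z).1.le
  refine ⟨fun y => γ y (ψ y), memHomeoPlusIso_of_displacement hγ hψ hψδ (by linarith) hρ hlip,
    fun y => hdist _ _ ((hψδ y).trans_lt hδη), ⟨T, ?_⟩, ?_⟩
  · rintro _ ⟨z, hz, rfl⟩
    simp only [hψφ ⟨z, hz⟩]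
    exact (hT ⟨z, hz⟩).2.1
  · rw [eq_empty_iff_forall_notMem]
    rintro _ ⟨⟨z, hz, rfl⟩, hzC⟩
    simp only [hψφ ⟨z, hz⟩] at hzC
    exact (hT ⟨z, hz⟩).2.2 hzC
end

section
/- Suppose (X, σ) is an irreducible shift of finite type, G is an abelian group, and f : X → G is a locally constant function which sums to zero over each periodic orbit: for every x ∈ X with σⁿ(x) = x, f(x) + f(σ(x)) + ⋯ + f(σ^{n−1}(x)) = 0. Then there is a locally constant function b : X → G such that f = b ∘ σ − b. -/
open Set Topology

section LivsicSFT

variable {A G : Type*}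

/-- The integer power `σ ^ k` of the shift. -/
def shiftBy (k : ℤ) (x : ℤ → A) : ℤ → A := fun i => x (i + k)

/-- Two bisequences agree on the window `[-N, N]`. -/
def AgreeOn (N : ℕ) (x y : ℤ → A) : Prop := ∀ i : ℤ, -N ≤ i → i ≤ N → x i = y i

/-- Membership in `X` is determined by the words of length `M + 1`. -/
def HasMemory (M : ℕ) (X : Set (ℤ → A)) : Prop :=
  ∀ x : ℤ → A,
    (∀ k : ℤ, ∃ y ∈ X, ∃ l : ℤ, ∀ i : ℤ, 0 ≤ i → i ≤ M → x (k + i) = y (l + i)) → x ∈ X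

/-- On `X`, the value of `f` depends only on the window `[-N, N]`. -/
def HasWindow (N : ℕ) (X : Set (ℤ → A)) (f : (ℤ → A) → G) : Prop :=
  ∀ x ∈ X, ∀ y ∈ X, AgreeOn N x y → f x = f y

/-- The sum of `f` along the first `n` points of the orbit of `x`. -/
def orbitSum [AddCommGroup G] (f : (ℤ → A) → G) (x : ℤ → A) (n : ℕ) : G :=
  ∑ i ∈ Finset.range n, f (shiftBy i x)

/-- There is an orbit segment of length `n` in `X` with `f`-sum `s`, starting in the `M`-window
of `x` and ending in the `M`-window of `y`. -/
def HasPath [AddCommGroup G] (M : ℕ) (X : Set (ℤ → A)) (f : (ℤ → A) → G) (x y : ℤ → A)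
    (n : ℕ) (s : G) : Prop :=
  ∃ z ∈ X, AgreeOn M z x ∧ AgreeOn M (shiftBy n z) y ∧ orbitSum f z n = s

theorem shiftMap_iterate (n : ℕ) (x : ℤ → A) : shiftMap^[n] x = shiftBy n x := by
  induction n with
  | zero => funext i; simp [shiftBy]
  | succ n ih =>
    rw [Function.iterate_succ_apply', ih]
    funext i
    simp only [shiftMap, shiftBy]
    congr 1
    push_cast
    ring

theorem shiftBy_zero (x : ℤ → A) : shiftBy 0 x = x := by
  funext i
  simp [shiftBy]

theorem AgreeOn.refl (N : ℕ) (x : ℤ → A) : AgreeOn N x x := fun _ _ _ => rfl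

theorem AgreeOn.symm {N : ℕ} {x y : ℤ → A} (h : AgreeOn N x y) : AgreeOn N y x :=
  fun i h₁ h₂ => (h i h₁ h₂).symm

theorem AgreeOn.trans {N : ℕ} {x y z : ℤ → A} (h : AgreeOn N x y) (h' : AgreeOn N y z) :
    AgreeOn N x z :=
  fun i h₁ h₂ => (h i h₁ h₂).trans (h' i h₁ h₂)

theorem AgreeOn.mono {N N' : ℕ} (hN : N ≤ N') {x y : ℤ → A} (h : AgreeOn N' x y) :
    AgreeOn N x y :=
  fun i h₁ h₂ => h i (by omega) (by omega)

theorem HasMemory.mono {M M' : ℕ} (hM : M ≤ M') {X : Set (ℤ → A)} (h : HasMemory M X) :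
    HasMemory M' X := by
  intro x hx
  refine h x fun k => ?_
  obtain ⟨y, hy, l, hl⟩ := hx k
  exact ⟨y, hy, l, fun i h₁ h₂ => hl i h₁ (by omega)⟩

theorem HasWindow.mono {N N' : ℕ} (hN : N ≤ N') {X : Set (ℤ → A)} {f : (ℤ → A) → G}
    (h : HasWindow N X f) : HasWindow N' X f :=
  fun x hx y hy hxy => h x hx y hy (hxy.mono hN)

theorem HasMemory.shiftBy_mem {M : ℕ} {X : Set (ℤ → A)} (h : HasMemory M X) {x : ℤ → A}
    (hx : x ∈ X) (k : ℤ) : shiftBy k x ∈ X :=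
  h _ fun l => ⟨x, hx, l + k, fun i _ _ => by simp only [shiftBy]; congr 1; ring⟩

theorem IsSFT.exists_hasMemory {X : Set (ℤ → A)} (h : IsSFT X) : ∃ M, HasMemory M X := by
  obtain ⟨F, hF, rfl⟩ := h
  obtain ⟨M, hM⟩ := (hF.image List.length).bddAbove
  refine ⟨M, fun x hx w hw k hocc => ?_⟩
  obtain ⟨y, hy, l, hl⟩ := hx k
  have hlen : w.length ≤ M := hM ⟨w, hw, rfl⟩
  exact hy w hw l fun i hi => by
    rw [← hocc i hi, hl i (by omega) (by omega)]

theorem isOpen_setOf_agreeOn [TopologicalSpace A] [DiscreteTopology A] (N : ℕ) (x : ℤ → A) :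
    IsOpen {y | AgreeOn N x y} := by
  have : {y | AgreeOn N x y} = Set.pi (Set.Icc (-N : ℤ) N) fun i => {x i} := by
    ext y
    simp only [AgreeOn, Set.mem_ofPred_eq, Set.mem_pi, Set.mem_Icc, Set.mem_singleton_iff, and_imp]
    exact forall_congr' fun i => forall_congr' fun _ => forall_congr' fun _ => eq_comm
  rw [this]
  exact isOpen_set_pi (Set.finite_Icc _ _) fun _ _ => isOpen_discrete _

theorem exists_agreeOn_subset [TopologicalSpace A] {V : Set (ℤ → A)} (hV : IsOpen V)
    {x : ℤ → A} (hx : x ∈ V) : ∃ N, ∀ y, AgreeOn N x y → y ∈ V := by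
  obtain ⟨I, u, hu, hsub⟩ := isOpen_pi_iff.1 hV x hx
  refine ⟨I.sup Int.natAbs, fun y hy => hsub fun i hi => ?_⟩
  have : i.natAbs ≤ I.sup Int.natAbs := Finset.le_sup (f := Int.natAbs) hi
  rw [← hy i (by omega) (by omega)]
  exact (hu i hi).2

theorem IsLocallyConstant.exists_hasWindow [Finite A] [TopologicalSpace A] [DiscreteTopology A]
    {X : Set (ℤ → A)} (hX : IsClosed X) {f : (ℤ → A) → G}
    (hf : IsLocallyConstant (X.restrict f)) : ∃ N, HasWindow N X f := by
  let U : ℕ → Set (ℤ → A) := fun N =>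
    {x | ∀ y ∈ X, ∀ y' ∈ X, AgreeOn N x y → AgreeOn N x y' → f y = f y'}
  have hopen : ∀ N, IsOpen (U N) := fun N => isOpen_iff_forall_mem_open.2 fun x hx =>
    ⟨{y | AgreeOn N x y},
      fun z hz y hy y' hy' h h' => hx y hy y' hy' (AgreeOn.trans hz h) (AgreeOn.trans hz h'),
      isOpen_setOf_agreeOn N x, AgreeOn.refl N x⟩
  have hmono : Monotone U := fun N N' hN x hx y hy y' hy' h h' =>
    hx y hy y' hy' (h.mono hN) (h'.mono hN)
  have hcover : X ⊆ ⋃ N, U N := by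
    intro x hx
    obtain ⟨V, hV, hVeq⟩ := isOpen_induced_iff.1 (hf {f x})
    have hval : ∀ y (hy : y ∈ X), y ∈ V ↔ f y = f x := fun y hy => by
      exact Set.ext_iff.1 hVeq ⟨y, hy⟩
    obtain ⟨N, hN⟩ := exists_agreeOn_subset hV ((hval x hx).2 rfl)
    exact Set.mem_iUnion.2 ⟨N, fun y hy y' hy' h h' =>
      ((hval y hy).1 (hN y h)).trans ((hval y' hy').1 (hN y' h')).symm⟩
  obtain ⟨N, hN⟩ := hX.isCompact.elim_directed_cover U hopen hcover hmono.directed_le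
  exact ⟨N, fun x hx y hy hxy => hN hx x hx y hy (AgreeOn.refl N x) hxy⟩

theorem HasWindow.isLocallyConstant [TopologicalSpace A] [DiscreteTopology A] {N : ℕ}
    {X : Set (ℤ → A)} {f : (ℤ → A) → G} (h : HasWindow N X f) :
    IsLocallyConstant (X.restrict f) := by
  refine (IsLocallyConstant.iff_exists_open _).2 fun x =>
    ⟨Subtype.val ⁻¹' {y | AgreeOn N x.1 y},
      (isOpen_setOf_agreeOn N x.1).preimage continuous_subtype_val, AgreeOn.refl N x.1,
      fun y hy => (h _ x.2 _ y.2 hy).symm⟩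

variable [AddCommGroup G]

/-- Orbit segments whose endpoint windows match can be concatenated. -/
theorem HasPath.append {M : ℕ} {X : Set (ℤ → A)} (hM : HasMemory M X) {f : (ℤ → A) → G}
    (hf : HasWindow M X f) {x y w : ℤ → A} {m n : ℕ} {s t : G}
    (hp : HasPath M X f x y m s) (hq : HasPath M X f y w n t) :
    HasPath M X f x w (m + n) (s + t) := by
  obtain ⟨p, hpX, hpx, hpy, rfl⟩ := hp
  obtain ⟨q, hqX, hqy, hqw, rfl⟩ := hq
  have hpq : AgreeOn M (shiftBy m p) q := hpy.trans hqy.symm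
  let z : ℤ → A := fun i => if i ≤ m then p i else q (i - m)
  have hleft : ∀ i : ℤ, i ≤ m + M → z i = p i := by
    intro i hi
    by_cases h : i ≤ m
    · simp [z, h]
    · have := hpq (i - m) (by omega) (by omega)
      simp only [z, h, if_false]
      rw [← this]
      simp [shiftBy]
  have hright : ∀ i : ℤ, m - M ≤ i → z i = q (i - m) := by
    intro i hi
    by_cases h : i ≤ m
    · have := hpq (i - m) (by omega) (by omega)
      simp only [z, h, if_true]
      rw [← this]
      simp [shiftBy]
    · simp [z, h]
  have hz : z ∈ X := by
    refine hM z fun k => ?_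
    by_cases hk : k ≤ m
    · exact ⟨p, hpX, k, fun i h₁ h₂ => hleft _ (by omega)⟩
    · refine ⟨q, hqX, k - m, fun i h₁ h₂ => ?_⟩
      rw [hright _ (by omega)]
      congr 1
      ring
  have hzp : ∀ j : ℕ, j ≤ m → AgreeOn M (shiftBy j z) (shiftBy j p) :=
    fun j hj i h₁ h₂ => hleft _ (by omega)
  have hzq : ∀ j : ℕ, AgreeOn M (shiftBy (m + j : ℕ) z) (shiftBy j q) := by
    intro j i h₁ h₂
    simp only [shiftBy]
    rw [hright _ (by push_cast; omega)]
    congr 1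
    push_cast
    ring
  refine ⟨z, hz, ?_, (hzq n).trans hqw, ?_⟩
  · exact AgreeOn.trans (fun i h₁ h₂ => hleft i (by omega)) hpx
  · rw [orbitSum, Finset.sum_range_add]
    congr 1
    · refine Finset.sum_congr rfl fun j hj => ?_
      exact hf _ (hM.shiftBy_mem hz _) _ (hM.shiftBy_mem hpX _)
        (hzp j (Finset.mem_range.1 hj).le)
    · exact Finset.sum_congr rfl fun j _ =>
        hf _ (hM.shiftBy_mem hz _) _ (hM.shiftBy_mem hqX _) (hzq j)

/-- A closed orbit segment is shadowed by a periodic point, so its sum vanishes. -/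
theorem HasPath.eq_zero {M : ℕ} {X : Set (ℤ → A)} (hM : HasMemory M X) {f : (ℤ → A) → G}
    (hf : HasWindow M X f)
    (hper : ∀ x ∈ X, ∀ n : ℕ, 0 < n → shiftBy n x = x → orbitSum f x n = 0)
    {x : ℤ → A} {n : ℕ} {s : G} (hn : 0 < n) (hp : HasPath M X f x x n s) : s = 0 := by
  obtain ⟨p, hpX, hpx, hpx', rfl⟩ := hp
  have hpp : AgreeOn M (shiftBy n p) p := hpx'.trans hpx.symm
  let z : ℤ → A := fun i => p (i % n)
  have hzper : ∀ i k : ℤ, z (i + k * n) = z i := fun i k => by simp [z]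
  have hbase : ∀ i : ℤ, 0 ≤ i → i < n → z i = p i := fun i h₁ h₂ => by
    simp only [z, Int.emod_eq_of_lt h₁ h₂]
  have hup : ∀ j : ℕ, j < n + M + 1 → z j = p j := by
    intro j
    induction j using Nat.strong_induction_on with
    | _ j ih =>
      intro hj
      by_cases h : j < n
      · exact hbase j (by omega) (by omega)
      · have h₁ := ih (j - n) (by omega) (by omega)
        have h₂ := hpp ((j - n : ℕ) : ℤ) (by omega) (by omega)
        have h₃ := hzper ((j - n : ℕ) : ℤ) 1
        have h₄ : ((j - n : ℕ) : ℤ) + n = j := by omega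
        simp only [shiftBy, one_mul, h₄] at h₂ h₃
        rw [h₃, h₁, h₂]
  have hdown : ∀ j : ℕ, j ≤ M → z (-j) = p (-j) := by
    intro j
    induction j using Nat.strong_induction_on with
    | _ j ih =>
      intro hj
      have h₂ : p (-j + n) = p (-j) := hpp (-(j : ℤ)) (by omega) (by omega)
      rw [← h₂, ← hzper _ 1, one_mul]
      by_cases h : j ≤ n
      · have h₄ : -(j : ℤ) + n = (n - j : ℕ) := by omega
        rw [h₄]
        exact hup _ (by omega)
      · have h₄ : -(j : ℤ) + n = -(j - n : ℕ) := by omega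
        rw [h₄]
        exact ih _ (by omega) (by omega)
  have hzp : ∀ i : ℤ, -M ≤ i → i ≤ n + M → z i = p i := by
    intro i h₁ h₂
    obtain ⟨j, rfl | rfl⟩ := i.eq_nat_or_neg
    · exact hup j (by omega)
    · exact hdown j (by omega)
  have hz : z ∈ X := by
    refine hM z fun k => ⟨p, hpX, k % n, fun i h₁ h₂ => ?_⟩
    have h₃ := Int.emod_nonneg k (b := n) (by omega)
    have h₄ := Int.emod_lt_of_pos k (b := n) (by omega)
    rw [← hzp _ (by omega) (by omega)]
    simp [z]
  rw [← hper z hz n hn (funext fun i => by simp [z, shiftBy])]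
  exact Finset.sum_congr rfl fun j hj => hf _ (hM.shiftBy_mem hpX _) _ (hM.shiftBy_mem hz _)
    fun i h₁ h₂ => (hzp _ (by omega) (by have := Finset.mem_range.1 hj; omega)).symm

theorem IsIrreducibleSubshift.exists_hasPath {X : Set (ℤ → A)} (hirr : IsIrreducibleSubshift X)
    {M : ℕ} (hM : HasMemory M X) (f : (ℤ → A) → G) {x y : ℤ → A} (hx : x ∈ X) (hy : y ∈ X) :
    ∃ n s, 0 < n ∧ HasPath M X f x y n s := by
  let word : (ℤ → A) → List A := fun a => List.ofFn fun i : Fin (2 * M + 1) => a (-M + (i : ℕ))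
  have hword : ∀ a ∈ X, wordOccursIn (word a) X := fun a ha =>
    ⟨a, ha, -M, fun i hi => by
      simp only [word, List.get_eq_getElem, List.getElem_ofFn]⟩
  obtain ⟨w, z, hz, k, hk⟩ := hirr _ _ (hword x hx) (hword y hy)
  have hlen : ∀ a, (word a).length = 2 * M + 1 := fun a => by simp [word]
  refine ⟨2 * M + 1 + w.length, _, by omega, shiftBy (k + M) z, hM.shiftBy_mem hz _,
    fun i h₁ h₂ => ?_, fun i h₁ h₂ => ?_, rfl⟩
  · obtain ⟨j, hj⟩ := Int.eq_ofNat_of_zero_le (show 0 ≤ i + M by omega)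
    have hj' : j < (word x).length := by rw [hlen]; omega
    have := hk j (by simp only [List.length_append]; omega)
    simp only [List.get_eq_getElem, List.append_assoc] at this
    rw [List.getElem_append_left hj'] at this
    simp only [word, List.getElem_ofFn] at this
    rw [show -(M : ℤ) + j = i by omega] at this
    rw [← this]
    simp only [shiftBy]
    congr 1
    omega
  · obtain ⟨j, hj⟩ := Int.eq_ofNat_of_zero_le (show 0 ≤ i + M by omega)
    have hj' : j < (word y).length := by rw [hlen]; omega
    have := hk (2 * M + 1 + w.length + j) (by
      simp only [List.length_append, hlen] at *
      omega)
    simp only [List.get_eq_getElem] at this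
    rw [List.getElem_append_right (by simp only [List.length_append, hlen]; omega)] at this
    simp only [List.length_append, hlen, Nat.add_sub_cancel_left] at this
    simp only [word, List.getElem_ofFn] at this
    rw [show -(M : ℤ) + j = i by omega] at this
    rw [← this]
    simp only [shiftBy]
    congr 1
    push_cast
    omega

end LivsicSFT

/-- Proposition 6.2 of the paper (a Livšic theorem for SFTs): a locally constant function on
an irreducible shift of finite type with zero sums over all periodic orbits is a locally
constant coboundary. -/
theorem sft_livsic {A : Type*} [Finite A] [TopologicalSpace A] [DiscreteTopology A]
    {G : Type*} [AddCommGroup G]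
    (X : Set (ℤ → A)) (hsub : IsSubshift X) (hSFT : IsSFT X) (hirr : IsIrreducibleSubshift X)
    (f : (ℤ → A) → G) (hf : IsLocallyConstant (X.restrict f))
    (hper : ∀ x ∈ X, ∀ n : ℕ, 0 < n → shiftMap^[n] x = x →
      ∑ i ∈ Finset.range n, f (shiftMap^[i] x) = 0) :
    ∃ b : (ℤ → A) → G, IsLocallyConstant (X.restrict b) ∧
      ∀ x ∈ X, f x = b (shiftMap x) - b x := by
  obtain ⟨M₀, hM₀⟩ := hSFT.exists_hasMemory
  obtain ⟨N₀, hN₀⟩ := hf.exists_hasWindow hsub.2.1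
  obtain ⟨M, hM, hw⟩ : ∃ M, HasMemory M X ∧ HasWindow M X f :=
    ⟨max M₀ N₀, hM₀.mono (le_max_left _ _), hN₀.mono (le_max_right _ _)⟩
  obtain ⟨x₀, hx₀⟩ := hsub.1
  have hzero : ∀ x ∈ X, ∀ n : ℕ, 0 < n → shiftBy n x = x → orbitSum f x n = 0 := by
    intro x hx n hn h
    simpa only [shiftMap_iterate, orbitSum] using hper x hx n hn (by rw [shiftMap_iterate, h])
  have huniq : ∀ x ∈ X, ∀ m n s t, HasPath M X f x₀ x m s → HasPath M X f x₀ x n t → s = t := by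
    intro x hx m n s t hs ht
    obtain ⟨k, r, hk, hr⟩ := hirr.exists_hasPath hM f hx hx₀
    have h₁ := (hs.append hM hw hr).eq_zero hM hw hzero (by omega)
    have h₂ := (ht.append hM hw hr).eq_zero hM hw hzero (by omega)
    exact add_right_cancel (h₁.trans h₂.symm)
  have hex : ∀ x, ∃ s, x ∈ X → ∃ n, HasPath M X f x₀ x n s := by
    intro x
    by_cases hx : x ∈ X
    · obtain ⟨n, s, -, h⟩ := hirr.exists_hasPath hM f hx₀ hx
      exact ⟨s, fun _ => ⟨n, h⟩⟩
    · exact ⟨0, fun h => absurd h hx⟩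
  choose b hb using hex
  have hbw : HasWindow M X b := by
    intro x hx y hy hxy
    obtain ⟨m, z, hz, h₀, h₁, hs⟩ := hb x hx
    obtain ⟨n, ht⟩ := hb y hy
    exact huniq y hy m n _ _ ⟨z, hz, h₀, h₁.trans hxy, hs⟩ ht
  refine ⟨b, hbw.isLocallyConstant, fun x hx => ?_⟩
  have hshift : shiftMap x = shiftBy (1 : ℕ) x := shiftMap_iterate 1 x
  have hσ : shiftMap x ∈ X := hshift ▸ hM.shiftBy_mem hx _
  obtain ⟨m, hm⟩ := hb x hx
  obtain ⟨n, hn⟩ := hb _ hσ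
  have hstep : HasPath M X f x (shiftMap x) 1 (f x) :=
    ⟨x, hx, AgreeOn.refl M x, hshift ▸ AgreeOn.refl M _, by simp [orbitSum, shiftBy_zero]⟩
  rw [huniq _ hσ _ _ _ _ hn (hm.append hM hw hstep), add_sub_cancel_left]
end
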